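/- arXiv:0709.3595 — 3 statements merged into one kernel-verified Lean document; each statement's English description precedes it below -/
import Mathlib

section
/- For every τ > 2, the Hausdorff dimension of J_τ = {x ∈ ℝ : |x - p/q| < q^{-τ} for infinitely many (p,q) ∈ ℤ × ℕ} is 2/τ. -/
open MeasureTheory Filter Topology Set
open scoped ENNReal NNReal

lemma limsup_null {ι : Type*} [Countable ι] (B : ι → Set ℝ) (d : ℝ) (hd : 0 < d)
    (h : ∑' i, Metric.ediam (B i) ^ d ≠ ∞) :
    μH[d] {x : ℝ | {i | x ∈ B i}.Infinite} = 0 := by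
  have ht := ENNReal.tendsto_tsum_compl_atTop_zero h
  have hr : Tendsto (fun S : Finset ι => (∑' i : {i // i ∉ S}, Metric.ediam (B i) ^ d) ^ (1/d))
      atTop (𝓝 0) := by
    have := (ENNReal.continuous_rpow_const (y := 1/d)).tendsto 0 |>.comp ht
    rw [ENNReal.zero_rpow_of_pos (by positivity)] at this
    exact this
  have key := Measure.hausdorffMeasure_le_liminf_tsum d {x : ℝ | {i | x ∈ B i}.Infinite}
    (l := atTop) (ι := fun S : Finset ι => {i // i ∉ S}) _ hr (fun S i => B i) ?_ ?_
  · rw [ht.liminf_eq] at key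
    exact le_antisymm key bot_le
  · refine Eventually.of_forall fun S i => ?_
    have h1 := ENNReal.le_tsum (f := fun i : {i // i ∉ S} => Metric.ediam (B i) ^ d) i
    have h2 := ENNReal.rpow_le_rpow h1 (z := 1/d) (by positivity)
    rwa [← ENNReal.rpow_mul, mul_one_div_cancel hd.ne', ENNReal.rpow_one] at h2
  · refine Eventually.of_forall fun S x hx => ?_
    obtain ⟨i, hi, hiS⟩ := hx.exists_notMem_finset S
    exact mem_iUnion.2 ⟨⟨i, hiS⟩, hi⟩

lemma upper_aux (τ : ℝ) (hτ : 2 < τ) (d : ℝ) (hd : 2 / τ < d) (M : ℕ) :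
    μH[d] ({x : ℝ | {pq : ℤ × ℕ | 0 < pq.2 ∧
      |x - (pq.1 : ℝ) / pq.2| < (pq.2 : ℝ) ^ (-τ)}.Infinite} ∩ {x | |x| ≤ M}) = 0 := by
  have hτ0 : 0 < τ := by linarith
  have hd0 : 0 < d := lt_trans (by positivity) hd
  let B : ℤ × ℕ → Set ℝ := fun i =>
    if 0 < i.2 ∧ i.1 ∈ Finset.Icc (-((M+1)*i.2 : ℤ)) ((M+1)*i.2 : ℤ) then
      Metric.ball ((i.1 : ℝ) / i.2) ((i.2 : ℝ) ^ (-τ)) else ∅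
  have hsum : ∑' i, Metric.ediam (B i) ^ d ≠ ∞ := by
    rw [ENNReal.tsum_prod', ENNReal.tsum_comm]
    have hq : ∀ q : ℕ, ∑' p : ℤ, Metric.ediam (B (p, q)) ^ d ≤
        ENNReal.ofReal ((2 * (M+1) + 1) * 2 ^ d * (q:ℝ) ^ (1 - τ * d)) := by
      intro q
      rcases Nat.eq_zero_or_pos q with rfl | hq
      · simp [B, hd0]
      have hqR : (0:ℝ) < q := by exact_mod_cast hq
      rw [tsum_eq_sum (s := Finset.Icc (-((M+1)*q : ℤ)) ((M+1)*q : ℤ))]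
      · have hb : ∀ p ∈ Finset.Icc (-((M+1)*q : ℤ)) ((M+1)*q : ℤ),
            Metric.ediam (B (p, q)) ^ d ≤ ENNReal.ofReal (2 ^ d * (q:ℝ) ^ (-τ * d)) := by
          intro p hp
          have : B (p, q) = Metric.ball ((p : ℝ) / q) ((q : ℝ) ^ (-τ)) := by
            simp only [B]; rw [if_pos ⟨hq, hp⟩]
          rw [this, Real.ball_eq_Ioo, Real.ediam_Ioo,
            show (p:ℝ) / q + (q:ℝ) ^ (-τ) - ((p:ℝ) / q - (q:ℝ) ^ (-τ)) = 2 * (q:ℝ) ^ (-τ) by ring,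
            ENNReal.ofReal_rpow_of_nonneg (by positivity) hd0.le,
            Real.mul_rpow (by norm_num) (by positivity), ← Real.rpow_mul hqR.le]
        refine (Finset.sum_le_sum hb).trans ?_
        rw [Finset.sum_const, Int.card_Icc, ← ENNReal.ofReal_nsmul]
        apply ENNReal.ofReal_le_ofReal
        rw [nsmul_eq_mul]
        have e1 : (q:ℝ) ^ (1 - τ * d) = q * (q:ℝ) ^ (-τ * d) := by
          rw [show 1 - τ * d = 1 + -τ * d by ring, Real.rpow_add hqR, Real.rpow_one]
        rw [e1]
        have e2 : (((((M:ℤ)+1)*q + 1 - -(((M:ℤ)+1)*q)).toNat : ℕ) : ℝ) ≤ (2 * (M+1) + 1) * q := by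
          have : ((M:ℤ)+1)*q + 1 - -(((M:ℤ)+1)*q) = ((2 * (M+1) * q + 1 : ℕ) : ℤ) := by
            push_cast; ring
          rw [this, Int.toNat_natCast]
          push_cast
          have : (1:ℝ) ≤ q := by exact_mod_cast hq
          nlinarith
        have := mul_le_mul_of_nonneg_right e2
          (show 0 ≤ 2 ^ d * (q:ℝ) ^ (-τ * d) by positivity)
        linarith
      · intro p hp
        have : B (p, q) = ∅ := by
          simp only [B]; rw [if_neg (fun h => hp h.2)]
        rw [this, Metric.ediam_empty, ENNReal.zero_rpow_of_pos hd0]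
    refine ne_top_of_le_ne_top ?_ (ENNReal.tsum_le_tsum hq)
    have hs : Summable fun q : ℕ => (2 * (M+1) + 1) * 2 ^ d * (q:ℝ) ^ (1 - τ * d) := by
      apply Summable.mul_left
      apply Real.summable_nat_rpow.2
      rw [div_lt_iff₀ hτ0] at hd
      nlinarith
    rw [← ENNReal.ofReal_tsum_of_nonneg (fun q => by positivity) hs]
    exact ENNReal.ofReal_ne_top
  refine measure_mono_null ?_ (limsup_null B d hd0 hsum)
  rintro x ⟨hx, hxM⟩
  refine Set.Infinite.mono ?_ hx
  rintro ⟨p, q⟩ ⟨hq, hpq⟩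
  simp only at hq hpq
  have hqR : (1:ℝ) ≤ q := by exact_mod_cast hq
  have hq0 : (0:ℝ) < q := by linarith
  have h1 : (q:ℝ) ^ (-τ) ≤ 1 := Real.rpow_le_one_of_one_le_of_nonpos hqR (by linarith)
  have hxM' : |x| ≤ M := hxM
  have h2 : |(p:ℝ) / q| ≤ M + 1 := by
    rw [abs_lt] at hpq; rw [abs_le] at hxM' ⊢
    constructor <;> linarith [hpq.1, hpq.2, hxM'.1, hxM'.2]
  have h3 : |(p:ℝ)| ≤ (M + 1) * q := by
    rw [abs_div, abs_of_pos hq0, div_le_iff₀ hq0] at h2; exact h2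
  have h4 : p ∈ Finset.Icc (-((M+1)*q : ℤ)) ((M+1)*q : ℤ) := by
    rw [abs_le] at h3
    rw [Finset.mem_Icc]
    constructor
    · exact_mod_cast h3.1
    · exact_mod_cast h3.2
  show x ∈ B (p, q)
  simp only [B]
  rw [if_pos ⟨hq, h4⟩, Metric.mem_ball, Real.dist_eq]
  exact hpq

lemma upper (τ : ℝ) (hτ : 2 < τ) :
    dimH {x : ℝ | {pq : ℤ × ℕ | 0 < pq.2 ∧
      |x - (pq.1 : ℝ) / pq.2| < (pq.2 : ℝ) ^ (-τ)}.Infinite} ≤ ENNReal.ofReal (2 / τ) := by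
  apply dimH_le
  intro d hd
  by_contra! hlt
  have hlt' : 2 / τ < d := by
    rw [← ENNReal.ofReal_coe_nnreal] at hlt
    exact (ENNReal.ofReal_lt_ofReal_iff_of_nonneg (by positivity)).1 hlt
  have : μH[d] {x : ℝ | {pq : ℤ × ℕ | 0 < pq.2 ∧
      |x - (pq.1 : ℝ) / pq.2| < (pq.2 : ℝ) ^ (-τ)}.Infinite} = 0 := by
    refine measure_mono_null ?_ (measure_iUnion_null fun M => upper_aux τ hτ d hlt' M)
    intro x hx
    obtain ⟨M, hM⟩ := exists_nat_ge |x|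
    exact mem_iUnion.2 ⟨M, hx, hM⟩
  rw [this] at hd
  exact ENNReal.zero_ne_top hd

lemma sep_count (S : Finset ℚ) (δ l : ℝ) (hδ : 0 < δ) (hl0 : 0 ≤ l)
    (hsep : ∀ r ∈ S, ∀ r' ∈ S, r ≠ r' → δ ≤ |(r:ℝ) - r'|)
    (hl : ∀ r ∈ S, ∀ r' ∈ S, |(r:ℝ) - r'| ≤ l) : (S.card : ℝ) ≤ l / δ + 1 := by
  rcases S.eq_empty_or_nonempty with rfl | hne
  · simp; positivity
  set m := S.min' hne with hm
  have hmS : m ∈ S := S.min'_mem hne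
  have hmin : ∀ r ∈ S, (m:ℝ) ≤ r := fun r hr => by exact_mod_cast S.min'_le r hr
  have hcard : S.card ≤ (Finset.range (⌊l / δ⌋₊ + 1)).card := by
    apply Finset.card_le_card_of_injOn (fun r : ℚ => ⌊((r:ℝ) - m) / δ⌋₊)
    · intro r hr
      simp only [Finset.coe_range, Set.mem_Iio]
      have := hl r hr m hmS
      apply Nat.lt_succ_of_le
      apply Nat.floor_le_floor
      gcongr
      exact (le_abs_self _).trans this
    · intro r hr r' hr' heq
      by_contra hne'
      have h1 := hsep r hr r' hr' hne'
      simp only at heq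
      have a1 : 0 ≤ ((r:ℝ) - m) / δ := div_nonneg (by linarith [hmin r hr]) hδ.le
      have a2 : 0 ≤ ((r':ℝ) - m) / δ := div_nonneg (by linarith [hmin r' hr']) hδ.le
      have b1 := Nat.floor_le a1
      have b2 := Nat.floor_le a2
      have c1 := Nat.lt_floor_add_one (((r:ℝ) - m) / δ)
      have c2 := Nat.lt_floor_add_one (((r':ℝ) - m) / δ)
      rw [heq] at b1 c1
      have : |((r:ℝ) - m) / δ - ((r':ℝ) - m) / δ| < 1 := by
        rw [abs_lt]; constructor <;> linarith
      rw [← sub_div, abs_div, abs_of_pos hδ, div_lt_one hδ] at this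
      rw [show (r:ℝ) - m - (r' - m) = r - r' by ring] at this
      linarith
  rw [Finset.card_range] at hcard
  have : (S.card : ℝ) ≤ ⌊l / δ⌋₊ + 1 := by exact_mod_cast hcard
  linarith [Nat.floor_le (show 0 ≤ l / δ by positivity)]

lemma rat_sep (r r' : ℚ) (h : r ≠ r') : 1 / ((r.den : ℝ) * r'.den) ≤ |(r:ℝ) - r'| := by
  have h1 : (0:ℝ) < r.den := by exact_mod_cast r.den_pos
  have h2 : (0:ℝ) < r'.den := by exact_mod_cast r'.den_pos
  have e : (r:ℝ) - r' = ((r.num * r'.den - r'.num * r.den : ℤ) : ℝ) / ((r.den : ℝ) * r'.den) := by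
    rw [Rat.cast_def r, Rat.cast_def r']
    push_cast
    field_simp
  have hne : r.num * r'.den - r'.num * r.den ≠ 0 := by
    intro h0
    apply h
    rw [h0] at e
    simp at e
    exact_mod_cast sub_eq_zero.1 e
  rw [e, abs_div, abs_of_pos (mul_pos h1 h2)]
  gcongr
  exact_mod_cast Int.one_le_abs hne

lemma rat_sep_same (r r' : ℚ) (h : r ≠ r') (hd : r.den = r'.den) :
    1 / (r.den : ℝ) ≤ |(r:ℝ) - r'| := by
  have h1 : (0:ℝ) < r.den := by exact_mod_cast r.den_pos
  have e : (r:ℝ) - r' = ((r.num - r'.num : ℤ) : ℝ) / (r.den : ℝ) := by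
    rw [Rat.cast_def r, Rat.cast_def r', ← hd]
    push_cast
    field_simp
  have hne : r.num - r'.num ≠ 0 := by
    intro h0
    apply h
    rw [h0] at e
    simp at e
    exact_mod_cast sub_eq_zero.1 e
  rw [e, abs_div, abs_of_pos h1]
  gcongr
  exact_mod_cast Int.one_le_abs hne

lemma farey_finite (x R : ℝ) (Q : ℕ) : {r : ℚ | r.den ≤ Q ∧ |(r:ℝ) - x| ≤ R}.Finite := by
  obtain ⟨M, hM⟩ := exists_nat_ge ((|x| + R) * Q)
  refine (((Set.finite_Icc (-(M:ℤ)) M).prod (Set.finite_Iic Q)).image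
    (fun pq : ℤ × ℕ => (pq.1 : ℚ) / pq.2)).subset ?_
  rintro r ⟨h1, h2⟩
  refine ⟨(r.num, r.den), ⟨?_, h1⟩, Rat.num_div_den r⟩
  have hd : (0:ℝ) < r.den := by exact_mod_cast r.den_pos
  have h1' : (r.den:ℝ) ≤ Q := by exact_mod_cast h1
  have h3 : |(r:ℝ)| ≤ |x| + R := by
    have := abs_add_le ((r:ℝ) - x) x
    rw [sub_add_cancel] at this
    linarith
  have h4 : |(r.num : ℝ)| ≤ M := by
    have e : (r.num : ℝ) = r * r.den := by
      rw [Rat.cast_def r]; field_simp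
    rw [e, abs_mul, abs_of_pos hd]
    refine le_trans ?_ hM
    have := abs_nonneg (r:ℝ)
    gcongr
    linarith
  rw [abs_le] at h4
  exact ⟨by exact_mod_cast h4.1, by exact_mod_cast h4.2⟩

lemma dirichlet_sum (x R : ℝ) (hR : 0 < R) (Q : ℕ) (hQ : 0 < Q) (hQR : 2 ≤ R * Q) (F : Finset ℚ)
    (hF : ∀ r : ℚ, r ∈ F ↔ r.den ≤ Q ∧ |(r:ℝ) - x| ≤ R) :
    R * Q / 2 ≤ ∑ r ∈ F, 1 / (r.den : ℝ) := by
  have hQ' : (0:ℝ) < Q := by exact_mod_cast hQ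
  have hcov : Metric.closedBall x (R/2) ⊆
      ⋃ r ∈ F, Metric.closedBall (r:ℝ) (1 / (Q * r.den)) := by
    intro y hy
    obtain ⟨r, hr1, hr2⟩ := Real.exists_rat_abs_sub_le_and_den_le y hQ
    have hd : (1:ℝ) ≤ r.den := by exact_mod_cast r.den_pos
    have hle : |y - r| ≤ 1 / (Q * r.den) := hr1.trans (by gcongr; linarith)
    have hle2 : 1 / (Q * (r.den:ℝ)) ≤ R / 2 := by
      rw [div_le_div_iff₀ (by positivity) (by norm_num)]
      nlinarith
    rw [Metric.mem_closedBall, Real.dist_eq] at hy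
    refine mem_iUnion₂.2 ⟨r, (hF r).2 ⟨hr2, ?_⟩, ?_⟩
    · have := abs_sub_le (r:ℝ) y x
      rw [abs_sub_comm (r:ℝ) y] at this
      linarith
    · rw [Metric.mem_closedBall, Real.dist_eq]; exact hle
  have h1 := (measure_mono hcov (μ := volume)).trans (measure_biUnion_finset_le F _)
  simp only [Real.volume_closedBall] at h1
  rw [← ENNReal.ofReal_sum_of_nonneg (fun r _ => by positivity),
    ENNReal.ofReal_le_ofReal_iff (Finset.sum_nonneg fun r _ => by positivity)] at h1
  have h2 : ∑ r ∈ F, 2 * (1 / ((Q:ℝ) * r.den)) = (2 / Q) * ∑ r ∈ F, 1 / (r.den : ℝ) := by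
    rw [Finset.mul_sum]
    refine Finset.sum_congr rfl fun r _ => ?_
    field_simp
  rw [h2] at h1
  have h3 : R * Q ≤ 2 * ∑ r ∈ F, 1 / (r.den : ℝ) := by
    calc R * Q = 2 * (R/2) * Q := by ring
      _ ≤ (2 / Q) * (∑ r ∈ F, 1 / (r.den : ℝ)) * Q := by gcongr
      _ = _ := by field_simp
  linarith

lemma farey (x R : ℝ) (hR : 0 < R) : ∀ᶠ Q : ℕ in atTop, ∃ F : Finset ℚ,
    (∀ r ∈ F, r.den ≤ Q ∧ |(r:ℝ) - x| ≤ R) ∧ R * Q ^ 2 / 128 ≤ F.card := by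
  have hces : ∀ᶠ Q : ℕ in atTop, (Q⁻¹ : ℝ) * ∑ i ∈ Finset.range Q, 1 / (i:ℝ) < R / 8 :=
    (tendsto_order.1 (tendsto_one_div_atTop_nhds_zero_nat (𝕜 := ℝ)).cesaro).2 _ (by positivity)
  have hlarge : ∀ᶠ Q : ℕ in atTop, 2 / R ≤ (Q:ℝ) :=
    tendsto_natCast_atTop_atTop.eventually_ge_atTop _
  filter_upwards [hces, hlarge, eventually_ge_atTop 32] with Q h1 h2 h3
  have hQ : 0 < Q := by omega
  have hQ' : (0:ℝ) < Q := by exact_mod_cast hQ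
  set F := (farey_finite x R Q).toFinset with hFdef
  have hF : ∀ r : ℚ, r ∈ F ↔ r.den ≤ Q ∧ |(r:ℝ) - x| ≤ R := by simp [hFdef]
  refine ⟨F, fun r hr => (hF r).1 hr, ?_⟩
  have hsum := dirichlet_sum x R hR Q hQ (by rwa [div_le_iff₀ hR, mul_comm] at h2) F hF
  rw [← Finset.sum_filter_add_sum_filter_not F (fun r => 32 * r.den ≤ Q)] at hsum
  have hbig : ∑ r ∈ F with ¬ (32 * r.den ≤ Q), 1 / (r.den : ℝ) ≤ F.card * (32 / Q) := by
    calc ∑ r ∈ F with ¬ (32 * r.den ≤ Q), 1 / (r.den : ℝ)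
        ≤ ∑ r ∈ F with ¬ (32 * r.den ≤ Q), (32 / Q : ℝ) := by
          refine Finset.sum_le_sum fun r hr => ?_
          have h := (Finset.mem_filter.1 hr).2
          have hd : (0:ℝ) < r.den := by exact_mod_cast r.den_pos
          have : (Q:ℝ) ≤ 32 * r.den := by
            have : Q ≤ 32 * r.den := by omega
            exact_mod_cast this
          rw [div_le_div_iff₀ hd hQ']
          linarith
      _ ≤ ∑ r ∈ F, (32 / Q : ℝ) :=
          Finset.sum_le_sum_of_subset_of_nonneg (Finset.filter_subset _ _)
            (fun _ _ _ => by positivity)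
      _ = _ := by rw [Finset.sum_const, nsmul_eq_mul]
  have hsmall : ∑ r ∈ F with 32 * r.den ≤ Q, 1 / (r.den : ℝ) ≤ R * Q / 4 := by
    have hmap : ∀ r ∈ F.filter (fun r => 32 * r.den ≤ Q), r.den ∈ Finset.range (Q / 32 + 1) := by
      intro r hr
      have h := (Finset.mem_filter.1 hr).2
      rw [Finset.mem_range]; omega
    rw [← Finset.sum_fiberwise_of_maps_to hmap]
    have hN : ∀ q ∈ Finset.range (Q / 32 + 1),
        ∑ r ∈ (F.filter (fun r => 32 * r.den ≤ Q)) with r.den = q, 1 / (r.den : ℝ) ≤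
          2 * R + 1 / q := by
      intro q _
      rcases Nat.eq_zero_or_pos q with rfl | hq
      · rw [Finset.sum_eq_zero]
        · simp; positivity
        · intro r hr
          have := (Finset.mem_filter.1 hr).2
          exact absurd this r.den_ne_zero
      have hq' : (0:ℝ) < q := by exact_mod_cast hq
      set G := (F.filter (fun r => 32 * r.den ≤ Q)).filter (fun r => r.den = q) with hG
      have hGF : ∀ r ∈ G, r ∈ F ∧ r.den = q := by
        intro r hr
        rw [hG, Finset.mem_filter, Finset.mem_filter] at hr
        exact ⟨hr.1.1, hr.2⟩
      have hc := sep_count G (1 / q) (2 * R) (by positivity) (by positivity) ?_ ?_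
      · rw [Finset.sum_congr rfl (fun r hr => by rw [(hGF r hr).2]), Finset.sum_const, nsmul_eq_mul]
        calc (G.card : ℝ) * (1 / q) ≤ (2 * R / (1 / q) + 1) * (1 / q) := by gcongr
          _ = 2 * R + 1 / q := by field_simp
      · intro r hr r' hr' hne
        have := rat_sep_same r r' hne ((hGF r hr).2.trans (hGF r' hr').2.symm)
        rwa [(hGF r hr).2] at this
      · intro r hr r' hr'
        have a := ((hF r).1 (hGF r hr).1).2
        have b := ((hF r').1 (hGF r' hr').1).2
        have := abs_sub_le (r:ℝ) x r'
        rw [abs_sub_comm x (r':ℝ)] at this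
        linarith
    refine (Finset.sum_le_sum hN).trans ?_
    rw [Finset.sum_add_distrib, Finset.sum_const, Finset.card_range, nsmul_eq_mul]
    have hk : ((Q / 32 + 1 : ℕ) : ℝ) ≤ Q / 16 := by
      have : 32 * (Q / 32 + 1) ≤ 2 * Q := by omega
      have : (32:ℝ) * ((Q / 32 + 1 : ℕ) : ℝ) ≤ 2 * Q := by exact_mod_cast this
      linarith
    have hH : ∑ i ∈ Finset.range (Q / 32 + 1), 1 / (i:ℝ) ≤ R / 8 * Q := by
      calc ∑ i ∈ Finset.range (Q / 32 + 1), 1 / (i:ℝ) ≤ ∑ i ∈ Finset.range Q, 1 / (i:ℝ) := by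
            apply Finset.sum_le_sum_of_subset_of_nonneg
            · apply Finset.range_subset_range.2; omega
            · intros; positivity
        _ ≤ R / 8 * Q := by
            rw [inv_mul_lt_iff₀ hQ'] at h1
            linarith
    have := mul_le_mul_of_nonneg_right hk (show 0 ≤ 2 * R by positivity)
    linarith
  have hfin : R * Q / 4 ≤ F.card * (32 / Q) := by linarith
  have := mul_le_mul_of_nonneg_right hfin hQ'.le
  have e : (F.card : ℝ) * (32 / Q) * Q = 32 * F.card := by field_simp
  rw [e] at this
  nlinarith

lemma good_mem (τ : ℝ) (hτ : 2 < τ) (x : ℝ)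
    (h : ∀ N : ℕ, ∃ Q : ℕ, N ≤ Q ∧ ∃ r : ℚ, r.den ≤ Q ∧ |x - r| < (Q:ℝ) ^ (-τ)) :
    {pq : ℤ × ℕ | 0 < pq.2 ∧ |x - (pq.1 : ℝ) / pq.2| < (pq.2 : ℝ) ^ (-τ)}.Infinite := by
  by_cases hx : ∃ r : ℚ, x = r
  · obtain ⟨r, rfl⟩ := hx
    have hd : (0:ℝ) < r.den := by exact_mod_cast r.den_pos
    refine Set.infinite_of_injective_forall_mem
      (f := fun n : ℕ => ((r.num * (n + 1), r.den * (n + 1)) : ℤ × ℕ)) ?_ ?_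
    · intro n m hnm
      have := (Prod.mk.inj hnm).2
      have := Nat.eq_of_mul_eq_mul_left r.den_pos this
      omega
    · intro n
      refine ⟨Nat.mul_pos r.den_pos n.succ_pos, ?_⟩
      have e : (r:ℝ) - ((r.num * (n + 1) : ℤ) : ℝ) / ((r.den * (n + 1) : ℕ) : ℝ) = 0 := by
        rw [Rat.cast_def r]
        push_cast
        field_simp
        ring
      simp only
      rw [e, abs_zero]
      apply Real.rpow_pos_of_pos
      exact_mod_cast Nat.mul_pos r.den_pos n.succ_pos
  · push Not at hx
    intro hfin
    have ht : Tendsto (fun Q : ℕ => (Q:ℝ) ^ (-τ)) atTop (𝓝 0) :=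
      (tendsto_rpow_neg_atTop (by linarith)).comp tendsto_natCast_atTop_atTop
    have hev : ∀ᶠ Q : ℕ in atTop, ∀ pq ∈ {pq : ℤ × ℕ | 0 < pq.2 ∧
        |x - (pq.1 : ℝ) / pq.2| < (pq.2 : ℝ) ^ (-τ)}, (Q:ℝ) ^ (-τ) < |x - (pq.1 : ℝ) / pq.2| := by
      rw [eventually_all_finite hfin]
      rintro ⟨p, q⟩ _
      refine (tendsto_order.1 ht).2 _ (abs_pos.2 (sub_ne_zero.2 ?_))
      have := hx ((p:ℚ) / q)
      push_cast at this
      exact this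
    obtain ⟨N, hN⟩ := eventually_atTop.1 hev
    obtain ⟨Q, hQN, r, hr, hxr⟩ := h N
    have hd : (0:ℝ) < r.den := by exact_mod_cast r.den_pos
    rw [Rat.cast_def r] at hxr
    have hle : (Q:ℝ) ^ (-τ) ≤ (r.den:ℝ) ^ (-τ) :=
      Real.rpow_le_rpow_of_nonpos hd (by exact_mod_cast hr) (by linarith)
    have := hN Q hQN (r.num, r.den) ⟨r.den_pos, lt_of_lt_of_le hxr hle⟩
    simp only at this
    linarith

/-- The set `t i` meets the closed ball. -/
def Hits (t : ℕ → Set ℝ) (x R : ℝ) : Set ℕ := {i | (t i ∩ Metric.closedBall x R).Nonempty}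

/-- The invariant of the nested construction. -/
def NestInv (t : ℕ → Set ℝ) (w : ℕ → ℝ) (s x R : ℝ) : Prop :=
  ∑' i, (Hits t x R).indicator (fun i => w i ^ s) i ≤ (R / 4096) ^ s

lemma eventually_params (τ s R : ℝ) (hτ : 2 < τ) (hsτ : τ * s < 2) (hR : 0 < R) :
    ∀ᶠ Q : ℕ in atTop, (Q:ℝ) ^ (-τ) / 2 ≤ R / 2 ∧ (Q:ℝ) ^ (-τ) / 2 ≤ 1 / (8 * Q ^ 2) ∧
      (R / ((Q:ℝ) ^ (-τ) / 2)) ^ s < R * Q ^ 2 / 512 := by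
  have ht : Tendsto (fun Q : ℕ => (Q:ℝ) ^ (-τ)) atTop (𝓝 0) :=
    (tendsto_rpow_neg_atTop (by linarith)).comp tendsto_natCast_atTop_atTop
  have ht2 : Tendsto (fun Q : ℕ => (Q:ℝ) ^ (-(τ - 2))) atTop (𝓝 0) :=
    (tendsto_rpow_neg_atTop (by linarith)).comp tendsto_natCast_atTop_atTop
  have ht3 : Tendsto (fun Q : ℕ => (2 * R) ^ s * (Q:ℝ) ^ (-(2 - τ * s))) atTop
      (𝓝 ((2 * R) ^ s * 0)) :=
    ((tendsto_rpow_neg_atTop (by linarith)).comp tendsto_natCast_atTop_atTop).const_mul _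
  rw [mul_zero] at ht3
  filter_upwards [(tendsto_order.1 ht).2 R hR, (tendsto_order.1 ht2).2 (1/4) (by norm_num),
    (tendsto_order.1 ht3).2 (R/512) (by positivity), eventually_gt_atTop 0] with Q h1 h2 h3 h4
  have hQ : (0:ℝ) < Q := by exact_mod_cast h4
  refine ⟨by linarith, ?_, ?_⟩
  · have e : (Q:ℝ) ^ (-τ) = (Q:ℝ) ^ (-(τ - 2)) / Q ^ 2 := by
      rw [eq_div_iff (by positivity), ← Real.rpow_natCast (Q:ℝ) 2, ← Real.rpow_add hQ]
      congr 1; push_cast; ring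
    rw [e, div_div, div_le_div_iff₀ (by positivity) (by positivity)]
    have : (0:ℝ) < Q ^ 2 := by positivity
    nlinarith
  · have e1 : R / ((Q:ℝ) ^ (-τ) / 2) = (2 * R) * (Q:ℝ) ^ τ := by
      rw [Real.rpow_neg hQ.le]; field_simp
    have e2 : (Q:ℝ) ^ (τ * s) = (Q:ℝ) ^ (-(2 - τ * s)) * Q ^ 2 := by
      rw [← Real.rpow_natCast (Q:ℝ) 2, ← Real.rpow_add hQ]
      congr 1; push_cast; ring
    rw [e1, Real.mul_rpow (by positivity) (by positivity), ← Real.rpow_mul hQ.le, e2]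
    have : (0:ℝ) < Q ^ 2 := by positivity
    have := mul_lt_mul_of_pos_right h3 this
    linarith

lemma step (τ s : ℝ) (hτ : 2 < τ) (hs0 : 0 < s) (hs1 : s < 1) (hsτ : τ * s < 2)
    (t : ℕ → Set ℝ) (w : ℕ → ℝ) (hw : ∀ i, 0 < w i)
    (hdiam : ∀ i, ∀ a ∈ t i, ∀ b ∈ t i, |a - b| ≤ w i) (hsum : Summable fun i => w i ^ s)
    (x R : ℝ) (hR : 0 < R) (hinv : NestInv t w s x R) (N : ℕ) :
    ∃ Q : ℕ, N ≤ Q ∧ 0 < Q ∧ ∃ r : ℚ, r.den ≤ Q ∧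
      Metric.closedBall (r:ℝ) ((Q:ℝ) ^ (-τ) / 2) ⊆ Metric.closedBall x R ∧
      NestInv t w s r ((Q:ℝ) ^ (-τ) / 2) ∧
      ∀ i ∈ Hits t r ((Q:ℝ) ^ (-τ) / 2), w i < 1 / (2 * Q ^ 2) := by
  obtain ⟨Q, ⟨F, hF, hcard⟩, ⟨hρR, hρQ, hgrow⟩, hNQ, hQ⟩ :=
    ((farey x (R/2) (by positivity)).and ((eventually_params τ s R hτ hsτ hR).and
      ((eventually_ge_atTop N).and (eventually_gt_atTop 0)))).exists
  refine ⟨Q, hNQ, hQ, ?_⟩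
  have hQ' : (0:ℝ) < Q := by exact_mod_cast hQ
  set ρ := (Q:ℝ) ^ (-τ) / 2 with hρdef
  have hρ : 0 < ρ := by positivity
  have hsub : ∀ r ∈ F, Metric.closedBall (r:ℝ) ρ ⊆ Metric.closedBall x R := by
    intro r hr
    apply Metric.closedBall_subset_closedBall'
    rw [Real.dist_eq]
    linarith [(hF r hr).2]
  set A : ℝ := ((ρ / 4096) ^ s)⁻¹ with hA
  have hA0 : 0 < A := by positivity
  set θ : ℝ := 1 / (2 * Q ^ 2) with hθ
  have hθ0 : 0 < θ := by positivity
  classical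
  set u : ℕ → ℝ := fun i => if w i < θ then A * w i ^ s else 1 with hu
  have hu0 : ∀ i, 0 ≤ u i := by
    intro i
    have := hw i
    simp only [hu]; split_ifs <;> positivity
  have hus : Summable u := by
    refine Summable.of_nonneg_of_le hu0 (fun i => ?_) (hsum.mul_left (A + (θ ^ s)⁻¹))
    have hwi := hw i
    have hp : 0 < w i ^ s := by positivity
    have hq : 0 < (θ ^ s)⁻¹ := by positivity
    simp only [hu]; split_ifs with h
    · nlinarith [mul_pos hq hp]
    · have : θ ^ s ≤ w i ^ s := Real.rpow_le_rpow hθ0.le (not_lt.1 h) hs0.le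
      have : 1 ≤ (θ ^ s)⁻¹ * w i ^ s := by
        rw [inv_mul_eq_div, le_div_iff₀ (by positivity)]; linarith
      nlinarith [mul_pos hA0 hp]
  have hind : ∀ r : ℚ, Summable ((Hits t r ρ).indicator u) := fun r => hus.indicator _
  -- bound of w on hit indices
  have hwle : ∀ i ∈ Hits t x R, w i ≤ R / 4096 := by
    intro i hi
    have h1 : (Hits t x R).indicator (fun i => w i ^ s) i ≤
        ∑' i, (Hits t x R).indicator (fun i => w i ^ s) i :=
      (hsum.indicator (Hits t x R)).le_tsum i (fun j _ => Set.indicator_nonneg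
        (fun j _ => (Real.rpow_pos_of_pos (hw j) s).le) j)
    rw [Set.indicator_of_mem hi] at h1
    exact (Real.rpow_le_rpow_iff (hw i).le (by positivity) hs0).1 (h1.trans hinv)
  have hcnt : ∀ i, ∑ r ∈ F, (Hits t (r:ℝ) ρ).indicator u i ≤
      (A + 4 * Q ^ 2 * (R / 4096) ^ (1 - s)) * (Hits t x R).indicator (fun i => w i ^ s) i := by
    intro i
    have hwi := hw i
    set G := F.filter (fun r : ℚ => i ∈ Hits t (r:ℝ) ρ) with hG
    have e : ∑ r ∈ F, (Hits t (r:ℝ) ρ).indicator u i = G.card * u i := by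
      rw [hG, ← nsmul_eq_mul, ← Finset.sum_const, Finset.sum_filter]
      refine Finset.sum_congr rfl fun r _ => ?_
      rw [Set.indicator_apply]
    rw [e]
    by_cases hi : i ∈ Hits t x R
    · rw [Set.indicator_of_mem hi]
      have hc := sep_count G (1 / (Q:ℝ) ^ 2) (2 * ρ + w i) (by positivity) (by positivity) ?_ ?_
      · have hc' : (G.card : ℝ) ≤ (2 * ρ + w i) * Q ^ 2 + 1 := by
          rwa [div_div_eq_mul_div, div_one] at hc
        have hρ2 : 2 * ρ * Q ^ 2 ≤ 1 / 4 := by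
          rw [le_div_iff₀ (by positivity)] at hρQ
          linarith
        have hp : 0 < w i ^ s := by positivity
        have hB : 0 < 4 * (Q:ℝ) ^ 2 * (R / 4096) ^ (1 - s) := by positivity
        by_cases hsm : w i < θ
        · have hui : u i = A * w i ^ s := by simp only [hu]; rw [if_pos hsm]
          have hwθ : w i * Q ^ 2 < 1 / 2 := by
            rw [hθ, lt_div_iff₀ (by positivity)] at hsm
            linarith
          have : (G.card : ℝ) < 2 := by linarith
          have : G.card < 2 := by exact_mod_cast this
          have : (G.card : ℝ) ≤ 1 := by exact_mod_cast Nat.lt_succ_iff.1 this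
          rw [hui]
          nlinarith [mul_pos hA0 hp, mul_pos hB hp]
        · have hui : u i = 1 := by simp only [hu]; rw [if_neg hsm]
          have hwθ : 1 / 2 ≤ w i * Q ^ 2 := by
            rw [hθ, not_lt, div_le_iff₀ (by positivity)] at hsm
            linarith
          have hw1 : w i ≤ (R / 4096) ^ (1 - s) * w i ^ s := by
            calc w i = w i ^ (1 - s) * w i ^ s := by
                  rw [← Real.rpow_add hwi]; simp
              _ ≤ _ := mul_le_mul_of_nonneg_right
                  (Real.rpow_le_rpow hwi.le (hwle i hi) (by linarith)) hp.le
          have hw2 := mul_le_mul_of_nonneg_left hw1 (show 0 ≤ 4 * (Q:ℝ) ^ 2 by positivity)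
          rw [hui]
          nlinarith [mul_pos hA0 hp]
      · intro r hr r' hr' hne
        have a := (hF r (Finset.mem_filter.1 hr).1).1
        have b := (hF r' (Finset.mem_filter.1 hr').1).1
        refine le_trans ?_ (rat_sep r r' hne)
        have ha : (0:ℝ) < r.den := by exact_mod_cast r.den_pos
        have hb : (0:ℝ) < r'.den := by exact_mod_cast r'.den_pos
        have a' : (r.den:ℝ) ≤ Q := by exact_mod_cast a
        have b' : (r'.den:ℝ) ≤ Q := by exact_mod_cast b
        rw [sq]
        gcongr
      · intro r hr r' hr'
        obtain ⟨y, hy, hyr⟩ := (Finset.mem_filter.1 hr).2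
        obtain ⟨z, hz, hzr⟩ := (Finset.mem_filter.1 hr').2
        rw [Metric.mem_closedBall, Real.dist_eq, abs_le] at hyr hzr
        have := abs_le.1 (hdiam i y hy z hz)
        rw [abs_le]
        constructor <;> linarith [hyr.1, hyr.2, hzr.1, hzr.2, this.1, this.2]
    · have : G = ∅ := by
        rw [hG, Finset.filter_eq_empty_iff]
        rintro r hr ⟨y, hy, hyr⟩
        exact hi ⟨y, hy, hsub r hr hyr⟩
      rw [this, Set.indicator_of_notMem hi]; simp
  have htot : ∑ r ∈ F, ∑' i, (Hits t (r:ℝ) ρ).indicator u i < F.card := by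
    rw [← Summable.tsum_finsetSum (fun r _ => hind r)]
    have hs1 : Summable fun i => ∑ r ∈ F, (Hits t (r:ℝ) ρ).indicator u i :=
      summable_sum fun r _ => hind r
    have hs2 := (hsum.indicator (Hits t x R)).mul_left (A + 4 * Q ^ 2 * (R / 4096) ^ (1 - s))
    have h1 := hs1.tsum_le_tsum hcnt hs2
    rw [tsum_mul_left] at h1
    have h2 := mul_le_mul_of_nonneg_left hinv
      (show 0 ≤ A + 4 * (Q:ℝ) ^ 2 * (R / 4096) ^ (1 - s) by positivity)
    have e1 : A * (R / 4096) ^ s = (R / ρ) ^ s := by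
      rw [hA, inv_mul_eq_div, ← Real.div_rpow (by positivity) (by positivity)]
      congr 1; field_simp
    have e2 : (R / 4096) ^ (1 - s) * (R / 4096) ^ s = R / 4096 := by
      rw [← Real.rpow_add (by positivity)]; simp
    have e3 : (A + 4 * (Q:ℝ) ^ 2 * (R / 4096) ^ (1 - s)) * (R / 4096) ^ s =
        (R / ρ) ^ s + 4 * Q ^ 2 * (R / 4096) := by
      rw [add_mul, e1, mul_assoc (4 * (Q:ℝ) ^ 2), e2]
    rw [e3] at h2
    have : 0 < R * (Q:ℝ) ^ 2 := by positivity
    have h3 := h1.trans h2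
    linarith
  obtain ⟨r, hr, hrlt⟩ : ∃ r ∈ F, ∑' i, (Hits t (r:ℝ) ρ).indicator u i < 1 := by
    apply Finset.exists_lt_of_sum_lt
    simpa using htot
  have hnl : ∀ i ∈ Hits t r ρ, w i < θ := by
    intro i hi
    by_contra hni
    have h1 := (hind r).le_tsum i (fun j _ => Set.indicator_nonneg (fun j _ => hu0 j) j)
    rw [Set.indicator_of_mem hi] at h1
    have : u i = 1 := by simp only [hu]; rw [if_neg hni]
    linarith
  refine ⟨r, (hF r hr).1, hsub r hr, ?_, hnl⟩
  have e : (Hits t r ρ).indicator u = fun i => A * (Hits t r ρ).indicator (fun i => w i ^ s) i := by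
    funext i
    by_cases hi : i ∈ Hits t r ρ
    · rw [Set.indicator_of_mem hi, Set.indicator_of_mem hi]
      simp only [hu]; rw [if_pos (hnl i hi)]
    · rw [Set.indicator_of_notMem hi, Set.indicator_of_notMem hi, mul_zero]
  rw [e, tsum_mul_left, hA, inv_mul_lt_iff₀ (by positivity), mul_one] at hrlt
  exact hrlt.le

lemma no_cover (τ s : ℝ) (hτ : 2 < τ) (hs0 : 0 < s) (hs1 : s < 1) (hsτ : τ * s < 2)
    (t : ℕ → Set ℝ) (w : ℕ → ℝ) (hw : ∀ i, 0 < w i)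
    (hdiam : ∀ i, ∀ a ∈ t i, ∀ b ∈ t i, |a - b| ≤ w i) (hsum : Summable fun i => w i ^ s)
    (hsmall : ∑' i, w i ^ s ≤ (1 / 4096) ^ s) :
    ∃ x : ℝ, {pq : ℤ × ℕ | 0 < pq.2 ∧ |x - (pq.1 : ℝ) / pq.2| < (pq.2 : ℝ) ^ (-τ)}.Infinite ∧
      x ∉ ⋃ i, t i := by
  let St := {c : ℝ × ℝ // 0 < c.2 ∧ NestInv t w s c.1 c.2}
  have hstep : ∀ (N : ℕ) (c : St), ∃ c' : St,
      Metric.closedBall c'.1.1 c'.1.2 ⊆ Metric.closedBall c.1.1 c.1.2 ∧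
      ∃ Q : ℕ, N ≤ Q ∧ 0 < Q ∧ (∃ r : ℚ, r.den ≤ Q ∧ ∀ y ∈ Metric.closedBall c'.1.1 c'.1.2,
        |y - r| < (Q:ℝ) ^ (-τ)) ∧ ∀ i ∈ Hits t c'.1.1 c'.1.2, w i < 1 / (2 * Q ^ 2) := by
    rintro N ⟨⟨x, R⟩, hR, hinv⟩
    obtain ⟨Q, hN, hQ, r, hr, hsub, hinv', hh⟩ :=
      step τ s hτ hs0 hs1 hsτ t w hw hdiam hsum x R hR hinv N
    have hQ' : (0:ℝ) < Q := by exact_mod_cast hQ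
    have hp : 0 < (Q:ℝ) ^ (-τ) := by positivity
    refine ⟨⟨((r:ℝ), (Q:ℝ) ^ (-τ) / 2), by positivity, hinv'⟩, hsub, Q, hN, hQ,
      ⟨r, hr, fun y hy => ?_⟩, hh⟩
    rw [Metric.mem_closedBall, Real.dist_eq] at hy
    simp only at hy
    linarith
  choose nxt hn1 hn2 using hstep
  let c0 : St := ⟨(0, 1), one_pos, by
    refine le_trans ?_ hsmall
    refine (hsum.indicator _).tsum_le_tsum (fun i => ?_) hsum
    exact Set.indicator_le_self' (fun _ _ => (Real.rpow_pos_of_pos (hw _) s).le) i⟩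
  let sq : ℕ → St := fun n => Nat.rec c0 (fun n c => nxt n c) n
  have hsq : ∀ n, sq (n + 1) = nxt n (sq n) := fun n => rfl
  obtain ⟨x, hx⟩ := IsCompact.nonempty_iInter_of_sequence_nonempty_isCompact_isClosed
    (fun n => Metric.closedBall (sq n).1.1 (sq n).1.2)
    (fun n => by simp only [hsq]; exact hn1 n (sq n))
    (fun n => ⟨_, Metric.mem_closedBall_self (sq n).2.1.le⟩)
    (isCompact_closedBall _ _) (fun n => Metric.isClosed_closedBall)
  rw [mem_iInter] at hx
  refine ⟨x, good_mem τ hτ x fun N => ?_, fun hxt => ?_⟩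
  · obtain ⟨Q, h1, h2, ⟨r, hr, hy⟩, h4⟩ := hn2 N (sq N)
    exact ⟨Q, h1, r, hr, hy x (hx (N + 1))⟩
  · obtain ⟨i, hi⟩ := mem_iUnion.1 hxt
    obtain ⟨N, hN⟩ := exists_nat_ge (1 / w i)
    obtain ⟨Q, h1, h2, _, h4⟩ := hn2 N (sq N)
    have hlt := h4 i ⟨x, hi, hx (N + 1)⟩
    have hwi := hw i
    have hQ1 : (1:ℝ) ≤ Q := by exact_mod_cast h2
    have hNQ : (N:ℝ) ≤ Q := by exact_mod_cast h1
    rw [div_le_iff₀ hwi] at hN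
    rw [lt_div_iff₀ (by positivity)] at hlt
    have h5 : (N:ℝ) * w i ≤ Q * w i := by gcongr
    have h6 : (Q:ℝ) * w i ≤ Q * w i * Q := le_mul_of_one_le_right (by positivity) hQ1
    nlinarith

lemma lower_aux (τ s : ℝ) (hτ : 2 < τ) (hs0 : 0 < s) (hs1 : s < 1) (hsτ : τ * s < 2) :
    μH[s] {x : ℝ | {pq : ℤ × ℕ | 0 < pq.2 ∧
      |x - (pq.1 : ℝ) / pq.2| < (pq.2 : ℝ) ^ (-τ)}.Infinite} ≠ 0 := by
  intro h0
  set J := {x : ℝ | {pq : ℤ × ℕ | 0 < pq.2 ∧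
      |x - (pq.1 : ℝ) / pq.2| < (pq.2 : ℝ) ^ (-τ)}.Infinite} with hJ
  set ε : ℝ := (1 / 4096) ^ s / 2 with hε
  have hε0 : 0 < ε := by positivity
  rw [Measure.hausdorffMeasure_apply] at h0
  have h1 : (⨅ (t : ℕ → Set ℝ) (_ : J ⊆ ⋃ n, t n) (_ : ∀ n, Metric.ediam (t n) ≤ 1),
          ∑' n, ⨆ _ : (t n).Nonempty, Metric.ediam (t n) ^ s) < ENNReal.ofReal ε := by
    refine lt_of_le_of_lt ?_ (ENNReal.ofReal_pos.2 hε0)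
    rw [← h0]
    exact le_iSup₂ (f := fun (r : ℝ≥0∞) (_ : 0 < r) =>
      ⨅ (t : ℕ → Set ℝ) (_ : J ⊆ ⋃ n, t n) (_ : ∀ n, Metric.ediam (t n) ≤ r),
          ∑' n, ⨆ _ : (t n).Nonempty, Metric.ediam (t n) ^ s) 1 one_pos
  simp only [iInf_lt_iff] at h1
  obtain ⟨t, hcov, hd1, hlt⟩ := h1
  have hsup : ∀ n, (⨆ _ : (t n).Nonempty, Metric.ediam (t n) ^ s) = Metric.ediam (t n) ^ s := by
    intro n
    rcases (t n).eq_empty_or_nonempty with h | h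
    · simp [h, hs0]
    · simp [h]
  simp only [hsup] at hlt
  have hfin : ∀ n, Metric.ediam (t n) ≠ ∞ := fun n => ne_top_of_le_ne_top ENNReal.one_ne_top (hd1 n)
  have hv : ∀ n, Metric.ediam (t n) ^ s = ENNReal.ofReal (Metric.diam (t n) ^ s) := by
    intro n
    rw [Metric.diam, ENNReal.toReal_rpow, ENNReal.ofReal_toReal]
    exact ENNReal.rpow_ne_top_of_nonneg hs0.le (hfin n)
  simp only [hv] at hlt
  have hvs : Summable fun n => Metric.diam (t n) ^ s := by
    have := ENNReal.summable_toReal hlt.ne_top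
    refine this.congr fun n => ?_
    rw [ENNReal.toReal_ofReal (Real.rpow_nonneg Metric.diam_nonneg _)]
  rw [← ENNReal.ofReal_tsum_of_nonneg (fun n => Real.rpow_nonneg Metric.diam_nonneg _) hvs,
    ENNReal.ofReal_lt_ofReal_iff hε0] at hlt
  have hpos : ∀ n, 0 < Metric.diam (t n) ^ s + ε / 2 / 2 ^ n := fun n =>
    add_pos_of_nonneg_of_pos (Real.rpow_nonneg Metric.diam_nonneg _) (by positivity)
  have hg := summable_geometric_two' ε
  have hws : ∀ n, ((Metric.diam (t n) ^ s + ε / 2 / 2 ^ n) ^ (1 / s)) ^ s =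
      Metric.diam (t n) ^ s + ε / 2 / 2 ^ n := by
    intro n
    rw [← Real.rpow_mul (hpos n).le, one_div_mul_cancel hs0.ne', Real.rpow_one]
  have hnc := no_cover τ s hτ hs0 hs1 hsτ t
    (fun n => (Metric.diam (t n) ^ s + ε / 2 / 2 ^ n) ^ (1 / s))
    (fun n => Real.rpow_pos_of_pos (hpos n) _) ?_ ?_ ?_
  · obtain ⟨x, hxJ, hx⟩ := hnc
    exact hx (hcov hxJ)
  · intro i a ha b hb
    have h2 : |a - b| ≤ Metric.diam (t i) := by
      rw [← Real.dist_eq]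
      exact Metric.dist_le_diam_of_mem' (hfin i) ha hb
    refine h2.trans ?_
    rw [← Real.rpow_le_rpow_iff Metric.diam_nonneg (Real.rpow_pos_of_pos (hpos i) _).le hs0, hws]
    have : 0 < ε / 2 / 2 ^ i := by positivity
    linarith
  · simp only [hws]
    exact hvs.add hg
  · simp only [hws]
    rw [hvs.tsum_add hg, tsum_geometric_two']
    linarith

theorem stmt2 (τ : ℝ) (hτ : 2 < τ) :
    dimH {x : ℝ |
        {pq : ℤ × ℕ | 0 < pq.2 ∧ |x - (pq.1 : ℝ) / pq.2| < (pq.2 : ℝ) ^ (-τ)}.Infinite} =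
      ENNReal.ofReal (2 / τ) := by
  have hτ0 : 0 < τ := by linarith
  refine le_antisymm (upper τ hτ) ?_
  refine le_of_forall_lt fun c hc => ?_
  obtain ⟨s, hcs, hs⟩ := ENNReal.lt_iff_exists_nnreal_btwn.1 hc
  have hs' : (s:ℝ) < 2 / τ := by
    rw [← ENNReal.ofReal_coe_nnreal] at hs
    exact (ENNReal.ofReal_lt_ofReal_iff (by positivity)).1 hs
  have hsτ : τ * s < 2 := by rw [lt_div_iff₀ hτ0] at hs'; linarith
  have hs0 : (0:ℝ) < s := by
    have : (0:ℝ≥0∞) < s := lt_of_le_of_lt bot_le hcs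
    exact_mod_cast this
  have hs1 : (s:ℝ) < 1 := by nlinarith
  exact lt_of_lt_of_le hcs
    (le_dimH_of_hausdorffMeasure_ne_zero (lower_aux τ s hτ hs0 hs1 hsτ))
end

section
/- If F ⊆ ℝ^d belongs to the class G^h(V) of sets with large intersection in a nonempty open set V with respect to a gauge function h, then H^g(F) = ∞ for every gauge function g with g ≺ h; in particular dim F ≥ sup{s ∈ (0,d) : r^s ≺ h}. -/
open MeasureTheory Set Filter

/-- `h ∈ 𝔇_d`: gauge function. -/
def IsGauge (d : ℕ) (h : ℝ → ℝ) : Prop :=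
  h 0 = 0 ∧ ∃ ε > 0, ContinuousOn h (Icc 0 ε) ∧ MonotoneOn h (Icc 0 ε) ∧
    (∀ r ∈ Ioc 0 ε, 0 < h r / r ^ d) ∧ AntitoneOn (fun r => h r / r ^ d) (Ioc 0 ε)

/-- `g` is a gauge function with admissible scale `ε`. -/
def IsGaugeOn (d : ℕ) (ε : ℝ) (g : ℝ → ℝ) : Prop :=
  g 0 = 0 ∧ 0 < ε ∧ ContinuousOn g (Icc 0 ε) ∧ MonotoneOn g (Icc 0 ε) ∧
    (∀ r ∈ Ioc 0 ε, 0 < g r / r ^ d) ∧ AntitoneOn (fun r => g r / r ^ d) (Ioc 0 ε)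

/-- `g ≺ h`: `g/h` monotonically tends to infinity at zero. -/
def GaugePrec (g h : ℝ → ℝ) : Prop :=
  Tendsto (fun r => g r / h r) (nhdsWithin 0 (Ioi 0)) atTop ∧
    ∃ ε > 0, AntitoneOn (fun r => g r / h r) (Ioc 0 ε)

/-- The `c`-adic cube `c^{-j}(k + [0,1)^d)`. -/
def cadicCube (d c : ℕ) (j : ℤ) (k : Fin d → ℤ) : Set (Fin d → ℝ) :=
  {x | ∀ s, x s ∈ Ico ((k s : ℝ) * (c : ℝ) ^ (-j)) (((k s : ℝ) + 1) * (c : ℝ) ^ (-j))}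

/-- The outer net measure `M^g_∞` built from `c`-adic cubes of diameter `< ε`. -/
noncomputable def netMeasure (d c : ℕ) (ε : ℝ) (g : ℝ → ℝ) (E : Set (Fin d → ℝ)) : ENNReal :=
  ⨅ (lam : ℕ → Set (Fin d → ℝ))
    (_ : ∀ p, lam p = ∅ ∨ ∃ j k, lam p = cadicCube d c j k)
    (_ : ∀ p, (EMetric.diam (lam p)).toReal < ε)
    (_ : E ⊆ ⋃ p, lam p),
    ∑' p, ENNReal.ofReal (g (EMetric.diam (lam p)).toReal)

/-- `F ∈ G^h(V)`: `F` is a `G_δ`-set and `M^g_∞(F ∩ U) = M^g_∞(U)` for every gauge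
function `g ≺ h` and every open `U ⊆ V`. -/
def LargeIntersection (d c : ℕ) (h : ℝ → ℝ) (V F : Set (Fin d → ℝ)) : Prop :=
  IsGδ F ∧ ∀ g ε, IsGaugeOn d ε g → GaugePrec g h →
    ∀ U : Set (Fin d → ℝ), IsOpen U → U ⊆ V →
      netMeasure d c ε g (F ∩ U) = netMeasure d c ε g U

lemma aux_gauge_nonneg {d : ℕ} {ε : ℝ} {g : ℝ → ℝ} (hg : IsGaugeOn d ε g) {r : ℝ}
    (hr : r ∈ Icc 0 ε) : 0 ≤ g r := by
  obtain ⟨h0, hε, -, hm, -, -⟩ := hg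
  have := hm ⟨le_refl _, hε.le⟩ hr hr.1
  rwa [h0] at this

lemma aux_gauge_pos {d : ℕ} {ε : ℝ} {g : ℝ → ℝ} (hg : IsGaugeOn d ε g) {r : ℝ}
    (hr : r ∈ Ioc 0 ε) : 0 < g r := by
  have h1 := hg.2.2.2.2.1 r hr
  have h2 : 0 < r ^ d := pow_pos hr.1 d
  have := mul_pos h1 h2
  rwa [div_mul_cancel₀ _ h2.ne'] at this

lemma aux_gauge_mono {d : ℕ} {ε δ : ℝ} {g : ℝ → ℝ} (hg : IsGaugeOn d ε g) (hδ : 0 < δ)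
    (hδε : δ ≤ ε) : IsGaugeOn d δ g := by
  obtain ⟨h0, hε, hc, hm, hp, ha⟩ := hg
  exact ⟨h0, hδ, hc.mono (Icc_subset_Icc_right hδε), hm.mono (Icc_subset_Icc_right hδε),
    fun r hr => hp r ⟨hr.1, hr.2.trans hδε⟩, ha.mono (Ioc_subset_Ioc_right hδε)⟩

lemma aux_cube_dist {d c : ℕ} {j : ℤ} {k : Fin d → ℤ} (hc : 2 ≤ c) {x y : Fin d → ℝ}
    (hx : x ∈ cadicCube d c j k) (hy : y ∈ cadicCube d c j k) :
    dist x y ≤ (c : ℝ) ^ (-j) := by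
  have hpos : 0 < (c : ℝ) ^ (-j) := zpow_pos (by positivity) _
  rw [dist_pi_le_iff hpos.le]
  intro s
  have h1 := hx s
  have h2 := hy s
  rw [Real.dist_eq, abs_le]
  simp only [mem_Ico] at h1 h2
  constructor <;> linarith [h1.1, h1.2, h2.1, h2.2]

lemma aux_cube_diam {d c : ℕ} {j : ℤ} {k : Fin d → ℤ} (hc : 2 ≤ c) :
    EMetric.diam (cadicCube d c j k) ≤ ENNReal.ofReal ((c : ℝ) ^ (-j)) :=
  Metric.ediam_le_of_forall_dist_le fun _ hx _ hy => aux_cube_dist hc hx hy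

lemma aux_cover {d c : ℕ} (hc : 2 ≤ c) (t : Set (Fin d → ℝ)) {δ : ℝ} (hδ : 0 < δ)
    (ht : ∀ x ∈ t, ∀ y ∈ t, dist x y ≤ δ) :
    ∃ j : ℤ, (c : ℝ) ^ (-j) ≤ δ ∧ ∃ k : (Fin d → Fin (2 * c + 1)) → (Fin d → ℤ),
      t ⊆ ⋃ i, cadicCube d c j (k i) := by
  have hc1 : (1 : ℝ) < c := by exact_mod_cast hc
  obtain ⟨n, hn1, hn2⟩ := exists_mem_Ico_zpow hδ hc1
  refine ⟨-n, by simpa using hn1, ?_⟩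
  set w : ℝ := (c : ℝ) ^ n with hw
  have hwpos : 0 < w := zpow_pos (by positivity) _
  have hn3 : δ < w * c := by rwa [zpow_add_one₀ (by positivity)] at hn2
  rcases t.eq_empty_or_nonempty with rfl | ⟨x, hx⟩
  · exact ⟨fun _ _ => 0, empty_subset _⟩
  refine ⟨fun i s => ⌊x s / w⌋ - c + (i s : ℕ), ?_⟩
  intro y hy
  have key : ∀ s, (0 : ℤ) ≤ ⌊y s / w⌋ - ⌊x s / w⌋ + c ∧
      ⌊y s / w⌋ - ⌊x s / w⌋ + c < 2 * c + 1 := by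
    intro s
    have h1 : |y s - x s| ≤ δ := by
      have := (dist_le_pi_dist y x s).trans (ht y hy x hx)
      rwa [Real.dist_eq] at this
    have h2 : |y s / w - x s / w| < c := by
      rw [← sub_div, abs_div, abs_of_pos hwpos, div_lt_iff₀ hwpos]
      nlinarith
    rw [abs_lt] at h2
    have a1 := Int.floor_le (y s / w)
    have a2 := Int.lt_floor_add_one (y s / w)
    have a3 := Int.floor_le (x s / w)
    have a4 := Int.lt_floor_add_one (x s / w)
    have b1 : (⌊y s / w⌋ : ℝ) < ((⌊x s / w⌋ + c + 1 : ℤ) : ℝ) := by push_cast; linarith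
    have b2 : (⌊x s / w⌋ : ℝ) < ((⌊y s / w⌋ + c + 1 : ℤ) : ℝ) := by push_cast; linarith
    have b1' := Int.cast_lt.1 b1
    have b2' := Int.cast_lt.1 b2
    constructor <;> omega
  rw [mem_iUnion]
  refine ⟨fun s => ⟨(⌊y s / w⌋ - ⌊x s / w⌋ + c).toNat, by have := key s; omega⟩, ?_⟩
  intro s
  have h3 : (((⌊y s / w⌋ - ⌊x s / w⌋ + c).toNat : ℕ) : ℤ) = ⌊y s / w⌋ - ⌊x s / w⌋ + c :=
    Int.toNat_of_nonneg (key s).1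
  have h4 : ⌊x s / w⌋ - c + (((⌊y s / w⌋ - ⌊x s / w⌋ + c).toNat : ℕ) : ℤ) = ⌊y s / w⌋ := by
    rw [h3]; ring
  simp only [h4, neg_neg, ← hw]
  have a1 := Int.floor_le (y s / w)
  have a2 := Int.lt_floor_add_one (y s / w)
  exact ⟨(le_div_iff₀ hwpos).1 a1, (div_lt_iff₀ hwpos).1 a2⟩

lemma aux_net_pos {d c : ℕ} (hd : 0 < d) (hc : 2 ≤ c) {ε : ℝ} {g : ℝ → ℝ}
    (hg : IsGaugeOn d ε g) {V : Set (Fin d → ℝ)} (hV : IsOpen V) (hVne : V.Nonempty) :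
    netMeasure d c ε g V ≠ 0 := by
  have hε := hg.2.1
  set κ := g ε / ε ^ d with hκ
  have hκ0 : 0 < κ := hg.2.2.2.2.1 ε ⟨hε, le_refl _⟩
  have hvol : volume V ≠ 0 := (hV.measure_pos volume hVne).ne'
  have main : ENNReal.ofReal κ * volume V ≤ netMeasure d c ε g V := by
    unfold netMeasure
    refine le_iInf fun lam => le_iInf fun h1 => le_iInf fun h2 => le_iInf fun h3 => ?_
    calc ENNReal.ofReal κ * volume V ≤ ENNReal.ofReal κ * ∑' p, volume (lam p) := by
          gcongr
          exact (measure_mono h3).trans (measure_iUnion_le _)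
      _ = ∑' p, ENNReal.ofReal κ * volume (lam p) := ENNReal.tsum_mul_left.symm
      _ ≤ _ := by
          refine ENNReal.tsum_le_tsum fun p => ?_
          have hfin : EMetric.diam (lam p) ≠ ⊤ := by
            rcases h1 p with h | ⟨j, k, h⟩
            · rw [h]; exact (Metric.ediam_empty (X := Fin d → ℝ)).trans_ne ENNReal.zero_ne_top
            · rw [h]; exact ne_top_of_le_ne_top ENNReal.ofReal_ne_top (aux_cube_diam hc)
          have hv : volume (lam p) ≤ EMetric.diam (lam p) ^ d := by
            have hv0 := Real.volume_pi_le_diam_pow (lam p)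
            rw [Fintype.card_fin] at hv0
            exact hv0
          set a := (EMetric.diam (lam p)).toReal with ha
          have ha' : EMetric.diam (lam p) = ENNReal.ofReal a := (ENNReal.ofReal_toReal hfin).symm
          have ha0 : 0 ≤ a := ENNReal.toReal_nonneg
          have haε : a < ε := h2 p
          have hga : κ * a ^ d ≤ g a := by
            rcases ha0.eq_or_lt with h | h
            · rw [← h, hg.1, zero_pow hd.ne']; simp
            · have := hg.2.2.2.2.2 ⟨h, haε.le⟩ ⟨hε, le_refl _⟩ haε.le
              exact (le_div_iff₀ (pow_pos h d)).1 this
          calc ENNReal.ofReal κ * volume (lam p)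
              ≤ ENNReal.ofReal κ * EMetric.diam (lam p) ^ d := by gcongr
            _ = ENNReal.ofReal (κ * a ^ d) := by
                rw [ha', ENNReal.ofReal_mul hκ0.le, ENNReal.ofReal_pow ha0]
            _ ≤ _ := ENNReal.ofReal_le_ofReal hga
  intro h0
  rw [h0] at main
  have := nonpos_iff_eq_zero.1 main
  rcases mul_eq_zero.1 this with h | h
  · exact absurd (ENNReal.ofReal_eq_zero.1 h) (not_le.2 hκ0)
  · exact hvol h

lemma aux_net_le {d c : ℕ} {ε : ℝ} {g : ℝ → ℝ} {E : Set (Fin d → ℝ)}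
    (lam : ℕ → Set (Fin d → ℝ))
    (h1 : ∀ p, lam p = ∅ ∨ ∃ j k, lam p = cadicCube d c j k)
    (h2 : ∀ p, (EMetric.diam (lam p)).toReal < ε) (h3 : E ⊆ ⋃ p, lam p) :
    netMeasure d c ε g E ≤ ∑' p, ENNReal.ofReal (g (EMetric.diam (lam p)).toReal) := by
  unfold netMeasure
  exact (iInf_le _ lam).trans ((iInf_le _ h1).trans ((iInf_le _ h2).trans (iInf_le _ h3)))

lemma aux_net_zero {d c : ℕ} (hc : 2 ≤ c) {ε : ℝ} {g : ℝ → ℝ}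
    (hg : IsGaugeOn d ε g) {E : Set (Fin d → ℝ)}
    (hE : Measure.mkMetric (fun r => ENNReal.ofReal (g r.toReal)) E = 0) :
    netMeasure d c ε g E = 0 := by
  have hε := hg.2.1
  set ι := (Fin d → Fin (2 * c + 1)) with hι
  set N : NNReal := (Fintype.card ι : NNReal) with hN
  have hN0 : 0 < N := by
    have : 0 < Fintype.card ι := Fintype.card_pos
    rw [hN]; exact_mod_cast this
  have key : ∀ η : NNReal, 0 < η → netMeasure d c ε g E ≤ (N : ENNReal) * (η + η) := by
    intro η hη
    rw [Measure.mkMetric_apply] at hE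
    have h1 : (⨅ (t : ℕ → Set (Fin d → ℝ)) (_ : E ⊆ iUnion t)
        (_ : ∀ n, Metric.ediam (t n) ≤ ENNReal.ofReal (ε / 2)),
        ∑' n, ⨆ _ : (t n).Nonempty, ENNReal.ofReal (g (Metric.ediam (t n)).toReal))
          < (η : ENNReal) := by
      refine lt_of_le_of_lt ?_ (ENNReal.coe_pos.2 hη)
      rw [← hE]
      exact le_iSup₂_of_le (ENNReal.ofReal (ε / 2)) (by simpa using hε) le_rfl
    simp only [iInf_lt_iff] at h1
    obtain ⟨t, htE, htd, hsum⟩ := h1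
    obtain ⟨η', hη', hηsum⟩ := ENNReal.exists_pos_sum_of_countable
      (ENNReal.coe_ne_zero.2 hη.ne') ℕ
    have hch : ∀ p, ∃ δ, 0 < δ ∧ δ < ε ∧ (∀ x ∈ t p, ∀ y ∈ t p, dist x y ≤ δ) ∧
        g δ ≤ g (Metric.ediam (t p)).toReal + η' p := by
      intro p
      set a := (Metric.ediam (t p)).toReal with ha
      have hfin : Metric.ediam (t p) ≠ ⊤ := ne_top_of_le_ne_top ENNReal.ofReal_ne_top (htd p)
      have ha0 : 0 ≤ a := ENNReal.toReal_nonneg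
      have haε : a < ε := by
        have := ENNReal.toReal_le_of_le_ofReal (by positivity) (htd p)
        linarith
      have hcont : ContinuousWithinAt g (Ioo a ε) a :=
        (hg.2.2.1 a ⟨ha0, haε.le⟩).mono fun x hx => ⟨ha0.trans hx.1.le, hx.2.le⟩
      have hcont' : Tendsto g (nhdsWithin a (Ioi a)) (nhds (g a)) := by
        rw [← nhdsWithin_Ioo_eq_nhdsGT haε]; exact hcont
      have e1 : ∀ᶠ x in nhdsWithin a (Ioi a), g x < g a + η' p :=
        hcont'.eventually_lt_const (by have := hη' p; simpa using this)
      have e2 : ∀ᶠ x in nhdsWithin a (Ioi a), x ∈ Ioo a ε := Ioo_mem_nhdsGT haε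
      obtain ⟨δ, hδ1, hδ2⟩ := (e1.and e2).exists
      refine ⟨δ, ha0.trans_lt hδ2.1, hδ2.2, ?_, hδ1.le⟩
      intro x hx y hy
      refine le_trans ?_ hδ2.1.le
      rw [dist_edist]
      exact ENNReal.toReal_mono hfin (Metric.edist_le_ediam_of_mem hx hy)
    choose δ hδ0 hδε hδd hδg using hch
    choose j hj k hk using fun p => aux_cover hc (t p) (hδ0 p) (hδd p)
    obtain ⟨⟨den⟩⟩ : Nonempty (Nonempty (ℕ ≃ ℕ × ι)) := by
      obtain ⟨D⟩ := nonempty_denumerable (ℕ × ι)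
      exact ⟨⟨(Denumerable.eqv (ℕ × ι)).symm⟩⟩
    have hdiam : ∀ p i, (EMetric.diam (cadicCube d c (j p) (k p i))).toReal ≤ δ p := fun p i =>
      (ENNReal.toReal_le_of_le_ofReal (zpow_nonneg (by positivity) _) (aux_cube_diam hc)).trans
        (hj p)
    refine (aux_net_le (fun n => cadicCube d c (j (den n).1) (k (den n).1 (den n).2))
      (fun p => Or.inr ⟨_, _, rfl⟩) (fun p => (hdiam _ _).trans_lt (hδε _)) ?_).trans ?_
    · intro x hx
      obtain ⟨p, hp⟩ := mem_iUnion.1 (htE hx)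
      obtain ⟨i, hi⟩ := mem_iUnion.1 (hk p hp)
      refine mem_iUnion.2 ⟨den.symm (p, i), ?_⟩
      simpa using hi
    · rw [den.tsum_eq (fun q : ℕ × ι => ENNReal.ofReal
        (g (EMetric.diam (cadicCube d c (j q.1) (k q.1 q.2))).toReal)), ENNReal.tsum_prod']
      calc ∑' p, ∑' i : ι, ENNReal.ofReal
              (g (EMetric.diam (cadicCube d c (j p) (k p i))).toReal)
          ≤ ∑' p, ∑' _i : ι, ((⨆ _ : (t p).Nonempty,
              ENNReal.ofReal (g (Metric.ediam (t p)).toReal)) + (η' p : ENNReal)) := by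
            refine ENNReal.tsum_le_tsum fun p => ENNReal.tsum_le_tsum fun i => ?_
            have s1 : g (EMetric.diam (cadicCube d c (j p) (k p i))).toReal ≤ g (δ p) :=
              hg.2.2.2.1 ⟨ENNReal.toReal_nonneg, (hdiam p i).trans (hδε p).le⟩
                ⟨(hδ0 p).le, (hδε p).le⟩ (hdiam p i)
            refine (ENNReal.ofReal_le_ofReal (s1.trans (hδg p))).trans ?_
            refine ENNReal.ofReal_add_le.trans ?_
            rw [ENNReal.ofReal_coe_nnreal]
            gcongr
            rcases (t p).eq_empty_or_nonempty with h | h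
            · simp [h, hg.1]
            · exact le_iSup (fun _ : (t p).Nonempty =>
                ENNReal.ofReal (g (Metric.ediam (t p)).toReal)) h
        _ = N * (∑' p, (⨆ _ : (t p).Nonempty,
              ENNReal.ofReal (g (Metric.ediam (t p)).toReal)) + ∑' p, (η' p : ENNReal)) := by
            rw [← ENNReal.tsum_add, ← ENNReal.tsum_mul_left]
            refine tsum_congr fun p => ?_
            rw [tsum_fintype, Finset.sum_const, nsmul_eq_mul]
            simp [hN]
        _ ≤ _ := by gcongr
  refine nonpos_iff_eq_zero.1 (ENNReal.le_of_forall_pos_le_add fun e he _ => ?_)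
  refine (key (e / (2 * N)) (by positivity)).trans ?_
  rw [zero_add, ← ENNReal.coe_add, ← ENNReal.coe_mul, ENNReal.coe_le_coe]
  apply le_of_eq
  field_simp
  norm_num

lemma aux_tendsto_toReal {P : ℝ → Prop} {ε : ℝ} (hε : 0 < ε) (h : ∀ r, 0 ≤ r → r < ε → P r) :
    ∀ᶠ r : ENNReal in nhds 0, r ≠ ⊤ ∧ P r.toReal := by
  have : ∀ᶠ r : ENNReal in nhds 0, r < ENNReal.ofReal ε :=
    gt_mem_nhds (ENNReal.ofReal_pos.2 hε)
  filter_upwards [this] with r hr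
  have hr' : r ≠ ⊤ := ne_top_of_lt hr
  exact ⟨hr', h _ ENNReal.toReal_nonneg ((ENNReal.lt_ofReal_iff_toReal_lt hr').1 hr)⟩

lemma aux_part1 (d c : ℕ) (hd : 0 < d) (hc : 2 ≤ c) (h : ℝ → ℝ) (hh : IsGauge d h)
    (V : Set (Fin d → ℝ)) (hV : IsOpen V) (hVne : V.Nonempty)
    (F : Set (Fin d → ℝ)) (hF : LargeIntersection d c h V F)
    (g : ℝ → ℝ) (hg : IsGauge d g) (hgh : GaugePrec g h) :
    MeasureTheory.Measure.mkMetric (fun r => ENNReal.ofReal (g r.toReal)) F = ⊤ := by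
  by_contra hne
  obtain ⟨hh0, εh, hεh, hhr⟩ := hh
  obtain ⟨hg0, εg, hεg, hgr⟩ := hg
  obtain ⟨htend, εq, hεq, hanti⟩ := hgh
  set ε := min (min εh εg) εq with hεdef
  have hε : 0 < ε := by positivity
  have Hh : IsGaugeOn d ε h := aux_gauge_mono (ε := εh) ⟨hh0, hεh, hhr⟩ hε
    ((min_le_left _ _).trans (min_le_left _ _))
  have Hg : IsGaugeOn d ε g := aux_gauge_mono (ε := εg) ⟨hg0, hεg, hgr⟩ hε
    ((min_le_left _ _).trans (min_le_right _ _))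
  have hanti' : AntitoneOn (fun r => g r / h r) (Ioc 0 ε) :=
    hanti.mono (Ioc_subset_Ioc_right (min_le_right _ _))
  let f : ℝ → ℝ := fun r => √(g r * h r)
  have hfq : ∀ r ∈ Ioc 0 ε, f r / r ^ d = √((g r / r ^ d) * (h r / r ^ d)) := by
    intro r hr
    have hrd : 0 < r ^ d := pow_pos hr.1 d
    have : (g r / r ^ d) * (h r / r ^ d) = (g r * h r) / (r ^ d) ^ 2 := by
      field_simp
    rw [this, Real.sqrt_div' _ (by positivity), Real.sqrt_sq hrd.le]
  have hfh : ∀ r ∈ Ioc 0 ε, f r / h r = √(g r / h r) := by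
    intro r hr
    have h1 := aux_gauge_pos Hh hr
    have : g r / h r = (g r * h r) / (h r) ^ 2 := by field_simp
    rw [this, Real.sqrt_div' _ (by positivity), Real.sqrt_sq h1.le]
  have Hf : IsGaugeOn d ε f := by
    refine ⟨by simp [f, hg0], hε, ?_, ?_, ?_, ?_⟩
    · exact (Hg.2.2.1.mul Hh.2.2.1).sqrt
    · intro x hx y hy hxy
      refine Real.sqrt_le_sqrt ?_
      exact mul_le_mul (Hg.2.2.2.1 hx hy hxy) (Hh.2.2.2.1 hx hy hxy)
        (aux_gauge_nonneg Hh hx) (aux_gauge_nonneg Hg hy)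
    · intro r hr
      rw [hfq r hr]
      exact Real.sqrt_pos.2 (mul_pos (Hg.2.2.2.2.1 r hr) (Hh.2.2.2.2.1 r hr))
    · intro x hx y hy hxy
      simp only [hfq x hx, hfq y hy]
      refine Real.sqrt_le_sqrt ?_
      exact mul_le_mul (Hg.2.2.2.2.2 hx hy hxy) (Hh.2.2.2.2.2 hx hy hxy)
        (Hh.2.2.2.2.1 y hy).le (Hg.2.2.2.2.1 x hx).le
  have hIoc : ∀ᶠ r in nhdsWithin (0 : ℝ) (Ioi 0), r ∈ Ioc 0 ε := Ioc_mem_nhdsGT hε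
  have Hfh : GaugePrec f h := by
    refine ⟨?_, ε, hε, ?_⟩
    · refine (Real.tendsto_sqrt_atTop.comp htend).congr' ?_
      filter_upwards [hIoc] with r hr
      exact (hfh r hr).symm
    · intro x hx y hy hxy
      simp only [hfh x hx, hfh y hy]
      exact Real.sqrt_le_sqrt (hanti' hx hy hxy)
  have hnet := hF.2 f ε Hf Hfh V hV subset_rfl
  have hpos := aux_net_pos hd hc Hf hV hVne
  rw [← hnet] at hpos
  apply hpos
  apply aux_net_zero hc Hf
  refine measure_mono_null inter_subset_left ?_
  have hsmall : ∀ e : NNReal, 0 < e →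
      Measure.mkMetric (fun r => ENNReal.ofReal (f r.toReal)) F
        ≤ (e : ENNReal) * Measure.mkMetric (fun r => ENNReal.ofReal (g r.toReal)) F := by
    intro e he
    have hev : ∀ᶠ r in nhdsWithin (0 : ℝ) (Ioi 0), f r ≤ e * g r := by
      filter_upwards [hIoc, htend.eventually_ge_atTop ((1 / (e : ℝ)) ^ 2)] with r hr hr2
      have h1 := aux_gauge_pos Hh hr
      have h2 := aux_gauge_pos Hg hr
      have he' : (0 : ℝ) < e := he
      refine Real.sqrt_le_iff.2 ⟨by positivity, ?_⟩
      rw [le_div_iff₀ h1] at hr2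
      have h3 : h r ≤ e ^ 2 * g r := by
        calc h r = e ^ 2 * ((1 / (e : ℝ)) ^ 2 * h r) := by field_simp
          _ ≤ e ^ 2 * g r := by gcongr
      calc g r * h r ≤ g r * (e ^ 2 * g r) := by gcongr
        _ = (e * g r) ^ 2 := by ring
    obtain ⟨u, hu, hsub⟩ := (mem_nhdsGT_iff_exists_Ioo_subset (α := ℝ)).1 hev
    have hu' : (0 : ℝ) < u := hu
    have hall : ∀ r, 0 ≤ r → r < u → f r ≤ e * g r := by
      intro r hr hru
      rcases hr.eq_or_lt with h | h
      · rw [← h]; simp [f, hg0]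
      · exact hsub ⟨h, hru⟩
    have hle := Measure.mkMetric_mono_smul (X := Fin d → ℝ)
      (m₁ := fun r => ENNReal.ofReal (f r.toReal))
      (m₂ := fun r => ENNReal.ofReal (g r.toReal)) (c := (e : ENNReal)) ENNReal.coe_ne_top
      (ENNReal.coe_ne_zero.2 he.ne') (by
        refine Filter.Eventually.filter_mono nhdsWithin_le_nhds ?_
        filter_upwards [aux_tendsto_toReal hu' hall] with r hr
        simp only [Pi.smul_apply, smul_eq_mul]
        refine (ENNReal.ofReal_le_ofReal hr.2).trans ?_
        rw [ENNReal.ofReal_mul e.coe_nonneg, ENNReal.ofReal_coe_nnreal])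
    exact hle F
  set A := Measure.mkMetric (fun r => ENNReal.ofReal (g r.toReal)) F with hA
  refine nonpos_iff_eq_zero.1 (ENNReal.le_of_forall_pos_le_add fun e he _ => ?_)
  have hA1 : A = (A.toNNReal : ENNReal) := (ENNReal.coe_toNNReal hne).symm
  refine (hsmall (e / (A.toNNReal + 1)) (by positivity)).trans ?_
  rw [hA1, zero_add, ← ENNReal.coe_mul, ENNReal.coe_le_coe, ENNReal.toNNReal_coe]
  rw [div_mul_eq_mul_div]
  refine div_le_of_le_mul₀ (by positivity) (by positivity) ?_
  gcongr
  exact le_self_add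

lemma aux_rpow_gauge {d : ℕ} {s : ℝ} (hs : s ∈ Ioo 0 (d : ℝ)) : IsGauge d (fun r => r ^ s) := by
  have hq : ∀ r : ℝ, 0 < r → r ^ s / r ^ d = r ^ (s - d) := fun r hr => by
    rw [Real.rpow_sub hr, Real.rpow_natCast]
  refine ⟨Real.zero_rpow hs.1.ne', 1, one_pos, ?_, ?_, ?_, ?_⟩
  · exact (Real.continuous_rpow_const hs.1.le).continuousOn
  · intro x hx y hy hxy
    exact Real.rpow_le_rpow hx.1 hxy hs.1.le
  · intro r hr
    have := hr.1
    positivity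
  · intro x hx y hy hxy
    simp only [hq x hx.1, hq y hy.1]
    exact Real.rpow_le_rpow_of_nonpos hx.1 hxy (by linarith [hs.2])

/-- Every `F ∈ G^h(V)` has infinite Hausdorff `g`-measure for each gauge `g ≺ h`;
in particular `dim F ≥ sup{s ∈ (0,d) : r^s ≺ h}`. -/
theorem stmt12 (d c : ℕ) (hd : 0 < d) (hc : 2 ≤ c) (h : ℝ → ℝ) (hh : IsGauge d h)
    (V : Set (Fin d → ℝ)) (hV : IsOpen V) (hVne : V.Nonempty)
    (F : Set (Fin d → ℝ)) (hF : LargeIntersection d c h V F) :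
    (∀ g : ℝ → ℝ, IsGauge d g → GaugePrec g h →
      MeasureTheory.Measure.mkMetric (fun r => ENNReal.ofReal (g r.toReal)) F = ⊤) ∧
    ∀ s : ℝ, s ∈ Set.Ioo 0 (d : ℝ) → GaugePrec (fun r => r ^ s) h →
      ENNReal.ofReal s ≤ dimH F := by
  have part1 := aux_part1 d c hd hc h hh V hV hVne F hF
  refine ⟨part1, fun s hs hsh => ?_⟩
  have htop := part1 _ (aux_rpow_gauge hs) hsh
  have hle := Measure.mkMetric_mono (X := Fin d → ℝ)
    (m₁ := fun r => ENNReal.ofReal (r.toReal ^ s)) (m₂ := fun r => r ^ s) (by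
      filter_upwards [aux_tendsto_toReal (P := fun _ => True) one_pos
        (fun _ _ _ => trivial)] with r hr
      rw [← ENNReal.ofReal_rpow_of_nonneg ENNReal.toReal_nonneg hs.1.le,
        ENNReal.ofReal_toReal hr.1])
  have h1 : Measure.hausdorffMeasure (X := Fin d → ℝ) s F = ⊤ :=
    top_unique (htop ▸ hle F)
  have h2 : ((s.toNNReal : NNReal) : ℝ) = s := Real.coe_toNNReal _ hs.1.le
  exact le_dimH_of_hausdorffMeasure_eq_top (d := s.toNNReal) (by rw [h2]; exact h1)
end

section
/- The class G^h(V) is closed under countable intersections: if F_n ∈ G^h(V) for all n ∈ ℕ, then ⋂_{n} F_n ∈ G^h(V). -/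
open MeasureTheory Set Filter

/-- Index type of cubes. -/
abbrev Idx (d : ℕ) := ℤ × (Fin d → ℤ)

/-- The cube with a given index. -/
def cub (d c : ℕ) (q : Idx d) : Set (Fin d → ℝ) := cadicCube d c q.1 q.2

lemma cub_eq_pi (d c : ℕ) (q : Idx d) : cub d c q =
    Set.pi univ fun s => Ico ((q.2 s : ℝ) * (c : ℝ) ^ (-q.1)) (((q.2 s : ℝ) + 1) * (c : ℝ) ^ (-q.1)) := by
  ext x; simp [cub, cadicCube]

lemma rad_pos {c : ℕ} (hc : 2 ≤ c) (j : ℤ) : 0 < (c : ℝ) ^ (-j) := by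
  have : (0 : ℝ) < c := by positivity
  positivity

lemma mem_cub {d c : ℕ} (hc : 2 ≤ c) (q : Idx d) (x : Fin d → ℝ) :
    x ∈ cub d c q ↔ ∀ s, ⌊x s * (c : ℝ) ^ q.1⌋ = q.2 s := by
  have h0 : 0 < (c : ℝ) ^ q.1 := by
    have : (0 : ℝ) < c := by positivity
    positivity
  simp only [cub, cadicCube, mem_ofPred_eq, mem_Ico, Int.floor_eq_iff, zpow_neg]
  refine forall_congr' fun s => ?_
  rw [← div_eq_mul_inv, ← div_eq_mul_inv, div_le_iff₀ h0, lt_div_iff₀ h0]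

lemma cub_nonempty {d c : ℕ} (hc : 2 ≤ c) (q : Idx d) : (cub d c q).Nonempty := by
  refine ⟨fun s => q.2 s * (c : ℝ) ^ (-q.1), ?_⟩
  have := rad_pos hc q.1
  intro s
  exact ⟨le_rfl, by nlinarith⟩

lemma floor_scale {c : ℕ} (hc : 2 ≤ c) {i j : ℤ} (hij : i ≤ j) (x : ℝ) :
    ⌊x * (c : ℝ) ^ i⌋ = ⌊x * (c : ℝ) ^ j⌋ / ((c ^ (j - i).toNat : ℕ) : ℤ) := by
  have h0 : (c : ℝ) ≠ 0 := by positivity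
  rw [← Int.floor_div_natCast]
  congr 1
  have : ((c ^ (j - i).toNat : ℕ) : ℝ) = (c : ℝ) ^ (j - i) := by
    rw [Nat.cast_pow, ← zpow_natCast, Int.toNat_of_nonneg (by omega)]
  rw [this, zpow_sub₀ h0]
  field_simp

lemma cub_subset_of_le {d c : ℕ} (hc : 2 ≤ c) {q q' : Idx d} (h : q.1 ≤ q'.1)
    (hne : (cub d c q ∩ cub d c q').Nonempty) : cub d c q' ⊆ cub d c q := by
  obtain ⟨x, hx, hx'⟩ := hne
  rw [mem_cub hc] at hx hx'
  intro y hy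
  rw [mem_cub hc] at hy ⊢
  intro s
  rw [← hx s, floor_scale hc h, floor_scale hc h, hx' s, hy s]

lemma cub_nested {d c : ℕ} (hc : 2 ≤ c) {q q' : Idx d}
    (hne : (cub d c q ∩ cub d c q').Nonempty) : cub d c q' ⊆ cub d c q ∨ cub d c q ⊆ cub d c q' := by
  rcases le_total q.1 q'.1 with h | h
  · exact Or.inl (cub_subset_of_le hc h hne)
  · exact Or.inr (cub_subset_of_le hc h (by rwa [inter_comm]))

lemma ediam_cub {d c : ℕ} (hd : 0 < d) (hc : 2 ≤ c) (q : Idx d) :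
    EMetric.diam (cub d c q) = ENNReal.ofReal ((c : ℝ) ^ (-q.1)) := by
  have e : ∀ s, Metric.ediam (Ico ((q.2 s : ℝ) * (c : ℝ) ^ (-q.1)) (((q.2 s : ℝ) + 1) * (c : ℝ) ^ (-q.1)))
      = ENNReal.ofReal ((c : ℝ) ^ (-q.1)) := by
    intro s
    rw [Real.ediam_Ico]; congr 1; ring
  apply le_antisymm
  · rw [cub_eq_pi]
    exact Metric.ediam_pi_le_of_le fun s => (e s).le
  · have h1 := (LipschitzWith.eval (α := fun _ : Fin d => ℝ) ⟨0, hd⟩).ediam_image_le (cub d c q)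
    have hn := cub_nonempty hc q
    rw [cub_eq_pi] at h1 hn
    rw [Set.eval_image_univ_pi hn, e] at h1
    rw [cub_eq_pi]
    rw [ENNReal.coe_one, one_mul] at h1
    exact h1

lemma diam_cub {d c : ℕ} (hd : 0 < d) (hc : 2 ≤ c) (q : Idx d) :
    (EMetric.diam (cub d c q)).toReal = (c : ℝ) ^ (-q.1) := by
  rw [ediam_cub hd hc, ENNReal.toReal_ofReal (rad_pos hc _).le]

lemma rad_le_iff {c : ℕ} (hc : 2 ≤ c) {i j : ℤ} : (c : ℝ) ^ (-i) ≤ (c : ℝ) ^ (-j) ↔ j ≤ i := by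
  have : (1 : ℝ) < c := by exact_mod_cast hc
  rw [zpow_le_zpow_iff_right₀ this]; omega

lemma le_of_cub_subset {d c : ℕ} (hd : 0 < d) (hc : 2 ≤ c) {q q' : Idx d}
    (h : cub d c q ⊆ cub d c q') : q'.1 ≤ q.1 := by
  have := Metric.ediam_mono h
  have h2 : EMetric.diam (cub d c q) ≤ EMetric.diam (cub d c q') := this
  rw [ediam_cub hd hc, ediam_cub hd hc, ENNReal.ofReal_le_ofReal_iff (rad_pos hc _).le, rad_le_iff hc] at h2
  exact h2

lemma cub_eq_of {d c : ℕ} (hc : 2 ≤ c) {q q' : Idx d} (h1 : q.1 = q'.1)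
    (hne : (cub d c q ∩ cub d c q').Nonempty) : q = q' := by
  obtain ⟨x, hx, hx'⟩ := hne
  rw [mem_cub hc] at hx hx'
  refine Prod.ext h1 (funext fun s => ?_)
  rw [← hx s, ← hx' s, h1]

lemma volume_cub {d c : ℕ} (hc : 2 ≤ c) (q : Idx d) :
    volume (cub d c q) = ENNReal.ofReal (((c : ℝ) ^ (-q.1)) ^ d) := by
  rw [cub_eq_pi, Real.volume_pi_Ico]
  have : ∀ s, ((q.2 s : ℝ) + 1) * (c : ℝ) ^ (-q.1) - (q.2 s : ℝ) * (c : ℝ) ^ (-q.1) = (c : ℝ) ^ (-q.1) := by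
    intro s; ring
  simp_rw [this]
  rw [Finset.prod_const, ENNReal.ofReal_pow (rad_pos hc _).le]
  simp

lemma frontier_null (d c : ℕ) (q : Idx d) : volume (frontier (cub d c q)) = 0 := by
  apply Convex.addHaar_frontier
  rw [cub_eq_pi]
  exact convex_pi fun s _ => convex_Ico _ _

lemma isCompact_closure_cub (d c : ℕ) (q : Idx d) : IsCompact (closure (cub d c q)) := by
  apply Bornology.IsBounded.isCompact_closure
  rw [cub_eq_pi]
  exact Bornology.IsBounded.pi fun s => Metric.isBounded_Ico _ _

/-- Cubes of diameter less than `ε`. -/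
def SmallCub (c : ℕ) (ε : ℝ) {d : ℕ} (q : Idx d) : Prop := (c : ℝ) ^ (-q.1) < ε

lemma finite_anc {d c : ℕ} (hd : 0 < d) (hc : 2 ≤ c) (ε : ℝ) (q : Idx d) :
    {a : Idx d | SmallCub c ε a ∧ cub d c q ⊆ cub d c a}.Finite := by
  have h1 : (1 : ℝ) < c := by exact_mod_cast hc
  obtain ⟨n, hn⟩ := pow_unbounded_of_one_lt ε h1
  refine Set.Finite.of_finite_image (f := Prod.fst) ((Set.finite_Icc (-(n : ℤ)) q.1).subset ?_) ?_
  · rintro _ ⟨a, ⟨ha, hs⟩, rfl⟩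
    refine ⟨?_, le_of_cub_subset hd hc hs⟩
    have h2 : (c : ℝ) ^ (-a.1) < (c : ℝ) ^ (n : ℤ) := by
      rw [zpow_natCast]; exact lt_trans ha hn
    rw [zpow_lt_zpow_iff_right₀ h1] at h2
    omega
  · rintro a ⟨_, ha⟩ b ⟨_, hb⟩ hab
    exact cub_eq_of hc hab ((cub_nonempty hc q).mono (subset_inter ha hb))

/-- SmallCub cubes around a point in an open set. -/
lemma exists_cub {d c : ℕ} (hd : 0 < d) (hc : 2 ≤ c) {ε : ℝ} (hε : 0 < ε) {A : Set (Fin d → ℝ)}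
    (hA : IsOpen A) {x : Fin d → ℝ} (hx : x ∈ A) :
    ∃ q : Idx d, SmallCub c ε q ∧ x ∈ cub d c q ∧ closure (cub d c q) ⊆ A := by
  obtain ⟨δ, hδ, hball⟩ := Metric.isOpen_iff.1 hA x hx
  have h1 : (1 : ℝ) < c := by exact_mod_cast hc
  obtain ⟨n, hn⟩ := exists_pow_lt_of_lt_one (lt_min hε hδ) (inv_lt_one_of_one_lt₀ h1)
  have hnn : (c : ℝ) ^ (-(n : ℤ)) < min ε δ := by
    rw [zpow_neg, zpow_natCast, ← inv_pow]; exact hn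
  let q : Idx d := (n, fun s => ⌊x s * (c : ℝ) ^ (n : ℤ)⌋)
  have hxq : x ∈ cub d c q := by rw [mem_cub hc]; intro s; rfl
  refine ⟨q, lt_of_lt_of_le hnn (min_le_left _ _), hxq, fun y hy => hball ?_⟩
  have h2 : edist y x ≤ Metric.ediam (closure (cub d c q)) :=
    Metric.edist_le_ediam_of_mem hy (subset_closure hxq)
  rw [Metric.ediam_closure] at h2
  have h3 := ediam_cub hd hc q
  change Metric.ediam _ = _ at h3
  rw [h3, edist_dist, ENNReal.ofReal_le_ofReal_iff (rad_pos hc _).le] at h2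
  exact lt_of_le_of_lt h2 (lt_of_lt_of_le hnn (min_le_right _ _))

/-- The weight of a cube. -/
noncomputable def wt (c : ℕ) (g : ℝ → ℝ) {d : ℕ} (q : Idx d) : ENNReal :=
  ENNReal.ofReal (g ((c : ℝ) ^ (-q.1)))

/-- The cost of a family of cubes, as a measure on indices. -/
noncomputable def cost (d c : ℕ) (g : ℝ → ℝ) : Measure (Idx d) :=
  Measure.sum fun q => wt c g q • Measure.dirac q

lemma ms {d : ℕ} (S : Set (Idx d)) : MeasurableSet S := S.to_countable.measurableSet

lemma cost_apply (d c : ℕ) (g : ℝ → ℝ) (S : Set (Idx d)) :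
    cost d c g S = ∑' q, S.indicator (wt c g) q := by
  rw [cost, Measure.sum_apply _ (ms S)]
  refine tsum_congr fun q => ?_
  by_cases h : q ∈ S <;> simp [h]

lemma cost_singleton (d c : ℕ) (g : ℝ → ℝ) (q : Idx d) : cost d c g {q} = wt c g q := by
  rw [cost_apply, tsum_eq_single q]
  · simp
  · intro b hb; simp [hb]

lemma cost_le_of_finset {d c : ℕ} {g : ℝ → ℝ} {S : Set (Idx d)} {t : ENNReal}
    (h : ∀ T : Finset (Idx d), (T : Set (Idx d)) ⊆ S → cost d c g T ≤ t) : cost d c g S ≤ t := by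
  classical
  rw [cost_apply, ENNReal.tsum_eq_iSup_sum]
  refine iSup_le fun T => le_trans ?_ (h (T.filter (· ∈ S)) (by intro x; simp))
  rw [cost_apply]
  refine le_trans (Finset.sum_le_sum fun q hq => ?_) (ENNReal.sum_le_tsum T)
  by_cases hqS : q ∈ S <;> simp [hqS, hq]

/-- Union of a family. -/
def uni (d c : ℕ) (S : Set (Idx d)) : Set (Fin d → ℝ) := ⋃ q ∈ S, cub d c q

lemma net_le {d c : ℕ} (hd : 0 < d) (hc : 2 ≤ c) {ε : ℝ} (hε : 0 < ε) {g : ℝ → ℝ} (hg : g 0 = 0)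
    {E : Set (Fin d → ℝ)} {S : Set (Idx d)} (hS : ∀ q ∈ S, SmallCub c ε q) (hE : E ⊆ uni d c S) :
    netMeasure d c ε g E ≤ cost d c g S := by
  classical
  obtain ⟨f, hf⟩ := exists_injective_nat (Idx d)
  let lam : ℕ → Set (Fin d → ℝ) := fun p => ⋃ q ∈ {q | q ∈ S ∧ f q = p}, cub d c q
  have hlam1 : ∀ q ∈ S, lam (f q) = cub d c q := by
    intro q hq
    have : {q' | q' ∈ S ∧ f q' = f q} = {q} := by
      ext q'; constructor
      · rintro ⟨_, h⟩; exact hf h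
      · rintro rfl; exact ⟨hq, rfl⟩
    simp only [lam, this, mem_singleton_iff, iUnion_iUnion_eq_left]
  have hlam0 : ∀ p, (¬ ∃ q ∈ S, f q = p) → lam p = ∅ := by
    intro p hp
    simp only [lam, iUnion_eq_empty]
    intro q hq
    exact absurd ⟨q, hq.1, hq.2⟩ hp
  refine le_trans (iInf_le_of_le lam <| iInf_le_of_le ?_ <| iInf_le_of_le ?_ <| iInf_le_of_le ?_ le_rfl) ?_
  · intro p
    by_cases hp : ∃ q ∈ S, f q = p
    · obtain ⟨q, hq, rfl⟩ := hp
      exact Or.inr ⟨q.1, q.2, hlam1 q hq⟩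
    · exact Or.inl (hlam0 p hp)
  · intro p
    by_cases hp : ∃ q ∈ S, f q = p
    · obtain ⟨q, hq, rfl⟩ := hp
      rw [hlam1 q hq, diam_cub hd hc]; exact hS q hq
    · rw [hlam0 p hp]
      change (Metric.ediam _).toReal < _
      simpa using hε
  · intro x hx
    obtain ⟨q, hq, hxq⟩ := mem_iUnion₂.1 (hE hx)
    exact mem_iUnion.2 ⟨f q, by rwa [hlam1 q hq]⟩
  · rw [cost_apply]
    have hsupp : (Function.support fun p => ENNReal.ofReal (g (EMetric.diam (lam p)).toReal)) ⊆ range f := by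
      intro p hp
      by_contra hcon
      apply hp
      have : lam p = ∅ := hlam0 p (by rintro ⟨q, _, h⟩; exact hcon ⟨q, h⟩)
      simp only [this]
      change ENNReal.ofReal (g (Metric.ediam _).toReal) = 0
      simp [hg]
    rw [← hf.tsum_eq hsupp]
    refine ENNReal.tsum_le_tsum fun q => ?_
    by_cases hq : q ∈ S
    · rw [hlam1 q hq, diam_cub hd hc, indicator_of_mem hq, wt]
    · have : lam (f q) = ∅ := hlam0 _ (by rintro ⟨q', hq', h⟩; exact hq (hf h ▸ hq'))
      rw [this]
      change ENNReal.ofReal (g (Metric.ediam _).toReal) ≤ _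
      simp [hg]

lemma exists_of_net_lt {d c : ℕ} (hd : 0 < d) (hc : 2 ≤ c) {ε : ℝ} {g : ℝ → ℝ}
    {E : Set (Fin d → ℝ)} {t : ENNReal} (ht : netMeasure d c ε g E < t) :
    ∃ S : Set (Idx d), (∀ q ∈ S, SmallCub c ε q) ∧ E ⊆ uni d c S ∧ cost d c g S < t := by
  simp only [netMeasure, iInf_lt_iff] at ht
  obtain ⟨lam, h1, h2, h3, h4⟩ := ht
  refine ⟨{q | ∃ p, lam p = cub d c q}, ?_, ?_, lt_of_le_of_lt ?_ h4⟩
  · rintro q ⟨p, hp⟩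
    have := h2 p
    rwa [hp, diam_cub hd hc] at this
  · intro x hx
    obtain ⟨p, hp⟩ := mem_iUnion.1 (h3 hx)
    rcases h1 p with h | ⟨j, k, h⟩
    · rw [h] at hp; exact hp.elim
    · rw [h] at hp
      exact mem_iUnion₂.2 ⟨(j, k), ⟨p, h⟩, hp⟩
  · have : {q | ∃ p, lam p = cub d c q} = ⋃ p, {q | lam p = cub d c q} := by
      ext q; simp
    rw [this]
    refine le_trans (measure_iUnion_le _) (ENNReal.tsum_le_tsum fun p => ?_)
    by_cases hp : ∃ q : Idx d, lam p = cub d c q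
    · obtain ⟨q, hq⟩ := hp
      have : {q | lam p = cub d c q} = {q} := by
        ext q'; constructor
        · intro h
          have h : cub d c q = cub d c q' := hq.symm.trans h
          refine cub_eq_of hc (le_antisymm (le_of_cub_subset hd hc h.le) (le_of_cub_subset hd hc h.ge)) ?_
          rw [h, inter_self]; exact cub_nonempty hc q'
        · rintro rfl; exact hq
      rw [this, cost_singleton, hq, diam_cub hd hc, wt]
    · have : {q : Idx d | lam p = cub d c q} = ∅ := by
        ext q; simp only [mem_empty_iff_false, iff_false]; exact fun h => hp ⟨q, h⟩
      rw [this]; simp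

lemma net_mono {d c : ℕ} {ε : ℝ} {g : ℝ → ℝ} {E E' : Set (Fin d → ℝ)} (h : E ⊆ E') :
    netMeasure d c ε g E ≤ netMeasure d c ε g E' := by
  refine iInf_mono fun lam => iInf_mono fun _ => iInf_mono fun _ => ?_
  exact le_iInf fun hcv => iInf_le_of_le (h.trans hcv) le_rfl

/-- Points on no cube boundary. -/
def Xset (d c : ℕ) : Set (Fin d → ℝ) := ⋂ q : Idx d, (frontier (cub d c q))ᶜ

lemma volume_X_inter (d c : ℕ) (E : Set (Fin d → ℝ)) : volume E ≤ volume (Xset d c ∩ E) := by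
  have h0 : volume (Xset d c)ᶜ = 0 := by
    rw [Xset, compl_iInter, measure_iUnion_null_iff]
    intro q; rw [compl_compl]; exact frontier_null d c q
  calc volume E ≤ volume ((Xset d c ∩ E) ∪ (Xset d c)ᶜ) := measure_mono (by
        intro x hx; by_cases h : x ∈ Xset d c
        · exact Or.inl ⟨h, hx⟩
        · exact Or.inr h)
    _ ≤ _ := (measure_union_le _ _).trans (by rw [h0, add_zero])

/-- Subcubes of a cube. -/
def Dsc (d c : ℕ) (b : Idx d) : Set (Idx d) := {q | cub d c q ⊆ cub d c b}

lemma wt_le {d c : ℕ} (hd : 0 < d) (hc : 2 ≤ c) {ε : ℝ} {g : ℝ → ℝ} (hg : IsGaugeOn d ε g)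
    {b : Idx d} (hb : SmallCub c ε b) {S : Set (Idx d)} (hS : S ⊆ Dsc d c b)
    (hcov : Xset d c ∩ cub d c b ⊆ uni d c S) : wt c g b ≤ cost d c g S := by
  obtain ⟨-, hε, -, -, hpos, hanti⟩ := hg
  set κ : ENNReal := ENNReal.ofReal (g ((c : ℝ) ^ (-b.1)) / ((c : ℝ) ^ (-b.1)) ^ d) with hκ
  have hbm : (c : ℝ) ^ (-b.1) ∈ Ioc 0 ε := ⟨rad_pos hc _, le_of_lt hb⟩
  have h1 : wt c g b = κ * volume (cub d c b) := by
    rw [volume_cub hc, hκ, ← ENNReal.ofReal_mul (hpos _ hbm).le, wt]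
    congr 1
    have := (rad_pos hc b.1).ne'
    field_simp
  have h2 : volume (cub d c b) ≤ ∑' q : S, volume (cub d c q) := by
    refine (volume_X_inter d c _).trans ((measure_mono hcov).trans ?_)
    exact measure_biUnion_le _ S.to_countable _
  rw [h1, cost_apply, ← tsum_subtype]
  refine (mul_le_mul_right h2 κ).trans ?_
  rw [← ENNReal.tsum_mul_left]
  refine ENNReal.tsum_le_tsum fun q => ?_
  have hle := (rad_le_iff hc).2 (le_of_cub_subset hd hc (hS q.2))
  have hqm : (c : ℝ) ^ (-(q : Idx d).1) ∈ Ioc 0 ε := ⟨rad_pos hc _, hle.trans hbm.2⟩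
  rw [volume_cub hc, hκ, ← ENNReal.ofReal_mul (hpos _ hbm).le, wt]
  apply ENNReal.ofReal_le_ofReal
  have := hanti hqm hbm hle
  simp only at this
  have hp : 0 < ((c : ℝ) ^ (-(q : Idx d).1)) ^ d := pow_pos (rad_pos hc _) _
  exact (le_div_iff₀ hp).1 this

lemma coarsen {d c : ℕ} (hd : 0 < d) (hc : 2 ≤ c) {ε : ℝ} {g : ℝ → ℝ} (hg : IsGaugeOn d ε g)
    (Q : Finset (Idx d)) (hQ : ∀ q ∈ Q, SmallCub c ε q) {S : Set (Idx d)}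
    (hS : ∀ q ∈ S, SmallCub c ε q) (hcov : Xset d c ∩ uni d c Q ⊆ uni d c S) :
    ∃ S' : Set (Idx d), (∀ q ∈ S', SmallCub c ε q) ∧ cost d c g S' ≤ cost d c g S ∧
      ∀ q ∈ Q, ∃ a ∈ S', cub d c q ⊆ cub d c a := by
  classical
  let B := Q.filter fun q => ¬ ∃ a ∈ S, cub d c q ⊆ cub d c a
  let Bm := B.filter fun b => ∀ b' ∈ B, cub d c b ⊆ cub d c b' → b' = b
  have hBm : ∀ b ∈ B, ∃ b' ∈ Bm, cub d c b ⊆ cub d c b' := by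
    intro b hb
    obtain ⟨m, hm, hmin⟩ := Finset.exists_min_image (B.filter fun b' => cub d c b ⊆ cub d c b')
      Prod.fst ⟨b, by simp [hb]⟩
    rw [Finset.mem_filter] at hm
    refine ⟨m, Finset.mem_filter.2 ⟨hm.1, fun b' hb' hsub => ?_⟩, hm.2⟩
    have h1 := hmin b' (Finset.mem_filter.2 ⟨hb', hm.2.trans hsub⟩)
    have h2 := le_of_cub_subset hd hc hsub
    exact cub_eq_of hc (le_antisymm h2 h1)
      ((cub_nonempty hc m).mono (subset_inter hsub Subset.rfl))
  have hBmB : ∀ b ∈ Bm, b ∈ B := fun b hb => (Finset.mem_filter.1 hb).1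
  have hBQ : ∀ b ∈ B, b ∈ Q := fun b hb => (Finset.mem_filter.1 hb).1
  let D : Set (Idx d) := ⋃ b ∈ Bm, S ∩ Dsc d c b
  have hDS : D ⊆ S := iUnion₂_subset fun _ _ => inter_subset_left
  have hdisj : (Bm : Set (Idx d)).PairwiseDisjoint fun b => S ∩ Dsc d c b := by
    intro b hb b' hb' hne
    refine Set.disjoint_left.2 ?_
    rintro q ⟨_, hq⟩ ⟨_, hq'⟩
    have hb2 := (Finset.mem_filter.1 (Finset.mem_coe.1 hb)).2
    have hb2' := (Finset.mem_filter.1 (Finset.mem_coe.1 hb')).2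
    rcases cub_nested hc ((cub_nonempty hc q).mono (subset_inter hq hq')) with h | h
    · exact hne (hb2' b (hBmB _ hb) h)
    · exact hne (hb2 b' (hBmB _ hb') h).symm
  have hw : ∀ b ∈ Bm, wt c g b ≤ cost d c g (S ∩ Dsc d c b) := by
    intro b hb
    refine wt_le hd hc hg (hQ b (hBQ b (hBmB b hb))) inter_subset_right ?_
    rintro x ⟨hxX, hxb⟩
    obtain ⟨q, hq, hxq⟩ := mem_iUnion₂.1 (hcov ⟨hxX, mem_iUnion₂.2 ⟨b, hBQ b (hBmB b hb), hxb⟩⟩)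
    refine mem_iUnion₂.2 ⟨q, ⟨hq, ?_⟩, hxq⟩
    rcases cub_nested hc ⟨x, hxq, hxb⟩ with h | h
    · exact absurd ⟨q, hq, h⟩ (Finset.mem_filter.1 (hBmB b hb)).2
    · exact h
  refine ⟨(S \ D) ∪ Bm, ?_, ?_, ?_⟩
  · rintro q (hq | hq)
    · exact hS q hq.1
    · exact hQ q (hBQ q (hBmB q hq))
  · have h1 : cost d c g (Bm : Set (Idx d)) ≤ cost d c g D := by
      calc cost d c g (Bm : Set (Idx d)) = cost d c g (⋃ b ∈ Bm, {b}) := by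
            congr 1; ext; simp
        _ ≤ ∑ b ∈ Bm, cost d c g {b} := measure_biUnion_finset_le _ _
        _ ≤ ∑ b ∈ Bm, cost d c g (S ∩ Dsc d c b) := by
            refine Finset.sum_le_sum fun b hb => ?_
            rw [cost_singleton]; exact hw b hb
        _ = cost d c g D := (measure_biUnion_finset hdisj fun _ _ => ms _).symm
    calc cost d c g (S \ D ∪ Bm) ≤ cost d c g (S \ D) + cost d c g Bm := measure_union_le _ _
      _ ≤ cost d c g (S \ D) + cost d c g D := by gcongr
      _ = cost d c g S := by
        rw [← measure_union disjoint_sdiff_left (ms _), sdiff_union_of_subset hDS]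
  · intro q hq
    by_cases hqB : q ∈ B
    · obtain ⟨b, hb, hsub⟩ := hBm q hqB
      exact ⟨b, Or.inr hb, hsub⟩
    · have : ∃ a ∈ S, cub d c q ⊆ cub d c a := by
        by_contra hcon
        exact hqB (Finset.mem_filter.2 ⟨hq, hcon⟩)
      obtain ⟨a, ha, hsub⟩ := this
      by_cases haD : a ∈ D
      · obtain ⟨b, hb, hab⟩ := mem_iUnion₂.1 haD
        exact ⟨b, Or.inr hb, hsub.trans hab.2⟩
      · exact ⟨a, Or.inl ⟨ha, haD⟩, hsub⟩

/-- Inner approximation of open sets by finite unions of cubes. -/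
lemma inner_approx {d c : ℕ} (hd : 0 < d) (hc : 2 ≤ c) {ε : ℝ} {g : ℝ → ℝ} (hg : IsGaugeOn d ε g)
    {A : Set (Fin d → ℝ)} (hA : IsOpen A) {t : ENNReal} (ht : t < netMeasure d c ε g A) :
    ∃ Q : Finset (Idx d), (∀ q ∈ Q, closure (cub d c q) ⊆ A) ∧
      t < netMeasure d c ε g (Xset d c ∩ uni d c Q) := by
  classical
  by_contra! hcon
  obtain ⟨t', htt', ht'⟩ := exists_between ht
  let P : Idx d → Prop := fun q => SmallCub c ε q ∧ closure (cub d c q) ⊆ A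
  have key : ∀ Q : Finset (Idx d), ∃ S : Set (Idx d), (∀ q ∈ S, SmallCub c ε q) ∧
      cost d c g S ≤ t' ∧ ∀ q ∈ Q, P q → ∃ a ∈ S, cub d c q ⊆ cub d c a := by
    intro Q
    have h1 := hcon (Q.filter P) (fun q hq => (Finset.mem_filter.1 hq).2.2)
    obtain ⟨S, hS, hcov, hlt⟩ := exists_of_net_lt hd hc (lt_of_le_of_lt h1 htt')
    obtain ⟨S', hS', hle, hanc⟩ := coarsen hd hc hg (Q.filter P)
      (fun q hq => (Finset.mem_filter.1 hq).2.1) hS hcov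
    exact ⟨S', hS', hle.trans hlt.le, fun q hq hP => hanc q (Finset.mem_filter.2 ⟨hq, hP⟩)⟩
  choose S hS hcost hanc using key
  let u : Ultrafilter (Finset (Idx d)) := Ultrafilter.of atTop
  have hu : (u : Filter (Finset (Idx d))) ≤ atTop := Ultrafilter.of_le _
  let T : Set (Idx d) := {q | ∀ᶠ Q in (u : Filter (Finset (Idx d))), q ∈ S Q}
  have hTs : ∀ q ∈ T, SmallCub c ε q := by
    intro q hq
    obtain ⟨Q, hQ⟩ := Filter.Eventually.exists (f := (u : Filter (Finset (Idx d)))) hq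
    exact hS Q q hQ
  have hTc : cost d c g T ≤ t' := by
    refine cost_le_of_finset fun R hR => ?_
    have : ∀ᶠ Q in (u : Filter (Finset (Idx d))), ∀ q ∈ R, q ∈ S Q :=
      (Filter.eventually_all_finset R).2 fun q hq => hR hq
    obtain ⟨Q, hQ⟩ := this.exists
    exact (measure_mono (fun q hq => hQ q hq)).trans (hcost Q)
  have hTcov : A ⊆ uni d c T := by
    intro x hx
    obtain ⟨q, hqs, hxq, hqA⟩ := exists_cub hd hc hg.2.1 hA hx
    have h1 : ∀ᶠ Q in (u : Filter (Finset (Idx d))), q ∈ Q := by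
      refine hu ?_
      filter_upwards [Filter.eventually_ge_atTop ({q} : Finset (Idx d))] with Q hQ
      exact hQ (Finset.mem_singleton_self q)
    have h2 : ∀ᶠ Q in (u : Filter (Finset (Idx d))),
        ∃ a ∈ {a : Idx d | SmallCub c ε a ∧ cub d c q ⊆ cub d c a}, a ∈ S Q := by
      filter_upwards [h1] with Q hQ
      obtain ⟨a, ha, hsub⟩ := hanc Q q hQ ⟨hqs, hqA⟩
      exact ⟨a, ⟨hS Q a ha, hsub⟩, ha⟩
    obtain ⟨a, ha, haT⟩ := (Ultrafilter.eventually_exists_mem_iff (finite_anc hd hc ε q)).1 h2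
    exact mem_iUnion₂.2 ⟨a, haT, ha.2 hxq⟩
  exact absurd ((net_le hd hc hg.2.1 hg.1 hTs hTcov).trans hTc) (not_le.2 ht')

lemma X_inter_cub (d c : ℕ) (q : Idx d) : Xset d c ∩ cub d c q ⊆ interior (cub d c q) := by
  rintro x ⟨hX, hx⟩
  by_contra hcon
  exact mem_iInter.1 hX q ⟨subset_closure hx, hcon⟩

/-- One step of the construction. -/
lemma step_s13 {d c : ℕ} (hd : 0 < d) (hc : 2 ≤ c) {ε : ℝ} {g : ℝ → ℝ} (hg : IsGaugeOn d ε g)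
    {A : Set (Fin d → ℝ)} (hA : IsOpen A) {t : ENNReal} (ht : t < netMeasure d c ε g A) :
    ∃ E : Set (Fin d → ℝ), IsOpen E ∧ IsCompact (closure E) ∧ closure E ⊆ A ∧
      t < netMeasure d c ε g E := by
  obtain ⟨Q, hQ, hlt⟩ := inner_approx hd hc hg hA ht
  have hsub : closure (⋃ q ∈ Q, interior (cub d c q)) ⊆ ⋃ q ∈ Q, closure (cub d c q) := by
    refine closure_minimal (iUnion₂_mono fun q _ => interior_subset.trans subset_closure) ?_
    exact Q.finite_toSet.isClosed_biUnion fun q _ => isClosed_closure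
  refine ⟨⋃ q ∈ Q, interior (cub d c q), isOpen_biUnion fun q _ => isOpen_interior, ?_, ?_, ?_⟩
  · exact (Q.isCompact_biUnion fun q _ => isCompact_closure_cub d c q).of_isClosed_subset
      isClosed_closure hsub
  · exact hsub.trans (iUnion₂_subset hQ)
  · refine lt_of_lt_of_le hlt (net_mono ?_)
    rintro x ⟨hX, hx⟩
    obtain ⟨q, hq, hxq⟩ := mem_iUnion₂.1 hx
    exact mem_iUnion₂.2 ⟨q, hq, X_inter_cub d c q ⟨hX, hxq⟩⟩

lemma net_frontier {d c : ℕ} (hd : 0 < d) (hc : 2 ≤ c) {ε : ℝ} {g : ℝ → ℝ} (hg : IsGaugeOn d ε g)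
    {A : Set (Fin d → ℝ)} (hA : IsOpen A) (q : Idx d) :
    netMeasure d c ε g A ≤ netMeasure d c ε g ((frontier (cub d c q))ᶜ ∩ A) := by
  refine le_of_forall_lt fun t ht => ?_
  obtain ⟨Q, hQ, hlt⟩ := inner_approx hd hc hg hA ht
  refine lt_of_lt_of_le hlt (net_mono ?_)
  rintro x ⟨hX, hx⟩
  obtain ⟨p, hp, hxp⟩ := mem_iUnion₂.1 hx
  exact ⟨mem_iInter.1 hX q, hQ p hp (subset_closure hxp)⟩

/-- The core: countable intersections of open sets of full net measure. -/
lemma core {d c : ℕ} (hd : 0 < d) (hc : 2 ≤ c) {ε : ℝ} {g : ℝ → ℝ} (hg : IsGaugeOn d ε g)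
    {U : Set (Fin d → ℝ)} (hU : IsOpen U) (O : ℕ → Set (Fin d → ℝ)) (hO : ∀ n, IsOpen (O n))
    (hX : ⋂ n, O n ⊆ Xset d c)
    (hfull : ∀ n A, IsOpen A → A ⊆ U → netMeasure d c ε g A ≤ netMeasure d c ε g (O n ∩ A)) :
    netMeasure d c ε g U ≤ netMeasure d c ε g ((⋂ n, O n) ∩ U) := by
  refine le_of_forall_lt_imp_le_of_dense fun t ht => ?_
  let P := {A : Set (Fin d → ℝ) // IsOpen A ∧ A ⊆ U ∧ t < netMeasure d c ε g A}
  have hstep : ∀ (n : ℕ) (A : P), ∃ B : P, IsCompact (closure B.1) ∧ closure B.1 ⊆ O n ∩ A.1 := by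
    rintro n ⟨A, hA, hAU, hAt⟩
    obtain ⟨E, hE, hEc, hEA, hEt⟩ := step_s13 hd hc hg ((hO n).inter hA)
      (lt_of_lt_of_le hAt (hfull n A hA hAU))
    exact ⟨⟨E, hE, (subset_closure.trans hEA).trans (inter_subset_right.trans hAU), hEt⟩, hEc, hEA⟩
  choose nxt hn1 hn2 using hstep
  let a : ℕ → P := fun n => Nat.rec ⟨U, hU, Subset.rfl, ht⟩ (fun n A => nxt n A) n
  let K : ℕ → Set (Fin d → ℝ) := fun n => closure (a (n + 1)).1
  have hK : ∀ n, K n ⊆ O n ∩ (a n).1 := fun n => hn2 n (a n)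
  have hKanti : Antitone K := antitone_nat_of_succ_le fun n =>
    (hK (n + 1)).trans (inter_subset_right.trans subset_closure)
  have hKsub : ⋂ n, K n ⊆ (⋂ n, O n) ∩ U := by
    intro x hx
    rw [mem_iInter] at hx
    exact ⟨mem_iInter.2 fun n => (hK n (hx n)).1, (a 0).2.2.1 (hK 0 (hx 0)).2⟩
  by_contra! hlt
  obtain ⟨S, hS, hcov, hcost⟩ := exists_of_net_lt hd hc hlt
  obtain ⟨n, hn⟩ := exists_subset_nhds_of_isCompact (V := K) (U := uni d c S)
    hKanti.directed_ge (fun n => hn1 n (a n)) (by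
      intro x hx
      have hx' := hKsub hx
      obtain ⟨q, hq, hxq⟩ := mem_iUnion₂.1 (hcov hx')
      have : cub d c q ∈ nhds x := mem_interior_iff_mem_nhds.1 (X_inter_cub d c q ⟨hX hx'.1, hxq⟩)
      exact Filter.mem_of_superset this (subset_biUnion_of_mem (u := fun q => cub d c q) hq))
  have h1 := net_le hd hc hg.2.1 hg.1 hS (subset_closure.trans hn)
  exact absurd ((a (n + 1)).2.2.2.trans_le h1) (not_lt.2 hcost.le)

/-- The class `G^h(V)` is closed under countable intersections. -/
theorem stmt13 (d c : ℕ) (hd : 0 < d) (hc : 2 ≤ c) (h : ℝ → ℝ) (hh : IsGauge d h)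
    (V : Set (Fin d → ℝ)) (hV : IsOpen V) (hVne : V.Nonempty)
    (F : ℕ → Set (Fin d → ℝ)) (hF : ∀ n, LargeIntersection d c h V (F n)) :
    LargeIntersection d c h V (⋂ n, F n) := by
  refine ⟨IsGδ.iInter fun n => (hF n).1, fun g ε hg hgh U hU hUV => ?_⟩
  refine le_antisymm (net_mono inter_subset_right) ?_
  have hG : ∀ n, ∃ G : ℕ → Set (Fin d → ℝ), (∀ m, IsOpen (G m)) ∧ F n = ⋂ m, G m := fun n =>
    isGδ_iff_eq_iInter_nat.1 (hF n).1
  choose G hGo hGF using hG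
  let I := (ℕ × ℕ) ⊕ Idx d
  let O : I → Set (Fin d → ℝ) := fun i =>
    Sum.elim (fun p => G p.1 p.2) (fun q => (frontier (cub d c q))ᶜ) i
  obtain ⟨e, he⟩ := exists_surjective_nat I
  have hInt : ⋂ n, O (e n) = ⋂ i, O i := he.iInter_comp O
  have hmain := core hd hc hg hU (fun n => O (e n)) ?_ ?_ ?_
  · refine hmain.trans (net_mono (inter_subset_inter_left _ ?_))
    rw [hInt]
    refine subset_iInter fun n => ?_
    rw [hGF n]
    exact subset_iInter fun m => iInter_subset O (Sum.inl (n, m))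
  · intro n
    rcases e n with p | q
    · exact hGo p.1 p.2
    · exact isClosed_frontier.isOpen_compl
  · rw [hInt]
    exact subset_iInter fun q => iInter_subset O (Sum.inr q)
  · intro n A hA hAU
    rcases e n with p | q
    · rw [← (hF p.1).2 g ε hg hgh A hA (hAU.trans hUV)]
      refine net_mono (inter_subset_inter_left _ ?_)
      rw [hGF p.1]
      exact iInter_subset _ p.2
    · exact net_frontier hd hc hg hA q
end
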